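/- The group of self-homeomorphisms of the 2-sphere S² (the unit sphere in ℝ³) is strongly distorted: there exist m ∈ ℕ and a sequence (w_n)_{n∈ℕ} of natural numbers such that for every sequence (g_n)_{n∈ℕ} of homeomorphisms of S² there exists a subset S of Homeo(S²) of cardinality m with g_n ∈ S^{w_n} for every n. -/

import Mathlib

open Pointwise

instance instGroupHomeomorph (X : Type*) [TopologicalSpace X] : Group (X ≃ₜ X) where
  mul f g := g.trans f
  one := Homeomorph.refl X
  inv := Homeomorph.symm
  mul_assoc _ _ _ := Homeomorph.ext fun _ => rfl
  one_mul _ := Homeomorph.ext fun _ => rfl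
  mul_one _ := Homeomorph.ext fun _ => rfl
  inv_mul_cancel f := Homeomorph.ext fun x => f.symm_apply_apply x

/-- A group `G` is *strongly distorted* if there exist `m : ℕ` and a sequence
`w : ℕ → ℕ` such that for every sequence `g : ℕ → G` there is a subset `S` of `G`
of cardinality `m` with `g n ∈ S ^ (w n)` for every `n`. -/
def StronglyDistorted (G : Type*) [Group G] : Prop :=
  ∃ (m : ℕ) (w : ℕ → ℕ), ∀ g : ℕ → G, ∃ S : Set G,
    S.Finite ∧ S.ncard = m ∧ ∀ n, g n ∈ S ^ w n

open Set Metric Filter Topology Function MeasureTheory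

/-- A local form of Hurwitz's theorem: zeros persist under locally uniform perturbation. -/
theorem TendstoLocallyUniformlyOn.eventually_exists_zero {ι : Type*} {φ : Filter ι} {U : Set ℂ}
    (hU : IsOpen U) {F : ι → ℂ → ℂ} {f : ℂ → ℂ} (hF : ∀ i, DifferentiableOn ℂ (F i) U)
    (hf : DifferentiableOn ℂ f U) (h : TendstoLocallyUniformlyOn F f φ U) {b : ℂ} (hb : b ∈ U)
    (hfb : f b = 0) (hne : ¬ ∀ᶠ z in 𝓝 b, f z = 0) {V : Set ℂ} (hV : V ∈ 𝓝 b) :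
    ∀ᶠ i in φ, ∃ z ∈ V, F i z = 0 := by
  have han : AnalyticAt ℂ f b := hf.analyticAt (hU.mem_nhds hb)
  have hpunct := (han.eventually_eq_zero_or_eventually_ne_zero).resolve_left hne
  rw [eventually_nhdsWithin_iff] at hpunct
  obtain ⟨r, hr, hball⟩ := Metric.nhds_basis_closedBall.mem_iff.1
    (inter_mem (inter_mem hpunct hV) (hU.mem_nhds hb))
  have hsU : closedBall b r ⊆ U := fun z hz => (hball hz).2
  have hcs : IsCompact (sphere b r) := isCompact_sphere b r
  obtain ⟨m, hm, hmle⟩ : ∃ m > 0, ∀ z ∈ sphere b r, m ≤ ‖f z‖ := by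
    have hne : (sphere b r).Nonempty := NormedSpace.sphere_nonempty.2 hr.le
    obtain ⟨x, hx, hmin⟩ := hcs.exists_isMinOn hne
      ((hf.continuousOn.mono (sphere_subset_closedBall.trans hsU)).norm)
    refine ⟨‖f x‖, norm_pos_iff.2 ?_, fun z hz => hmin hz⟩
    have := (hball (sphere_subset_closedBall hx)).1.1
    exact this (by simpa using ne_of_mem_sphere hx hr.ne')
  have hunif : TendstoUniformlyOn F f φ (closedBall b r) :=
    (tendstoLocallyUniformlyOn_iff_tendstoUniformlyOn_of_compact (isCompact_closedBall b r)).1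
      (h.mono hsU)
  filter_upwards [Metric.tendstoUniformlyOn_iff.1 hunif (m / 2) (by positivity)] with i hi
  by_contra! hcon
  have hnz : ∀ z ∈ closedBall b r, F i z ≠ 0 := fun z hz => hcon z (hball hz).1.2
  have hd : DiffContOnCl ℂ (fun z => (F i z)⁻¹) (ball b r) := by
    refine DifferentiableOn.diffContOnCl ?_
    rw [closure_ball b hr.ne']
    exact ((hF i).mono hsU).inv hnz
  have hle : ‖(F i b)⁻¹‖ ≤ (m / 2)⁻¹ := by
    refine Complex.norm_le_of_forall_mem_frontier_norm_le isBounded_ball hd ?_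
      (subset_closure (mem_ball_self hr))
    intro z hz
    rw [frontier_ball b hr.ne'] at hz
    rw [norm_inv]
    refine inv_anti₀ (by positivity) ?_
    have h1 := hi z (sphere_subset_closedBall hz)
    have h2 := hmle z hz
    rw [dist_eq_norm] at h1
    have := norm_sub_norm_le (f z) (F i z)
    linarith
  have h1 := hi b (mem_closedBall_self hr.le)
  rw [hfb, dist_zero_left] at h1
  have h0 := norm_pos_iff.2 (hnz b (mem_closedBall_self hr.le))
  rw [norm_inv] at hle
  have := (inv_le_inv₀ h0 (by positivity)).1 hle
  linarith

/-- **Montel's theorem** for sequences of holomorphic functions bounded by one. -/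
theorem exists_tendstoLocallyUniformlyOn_of_mapsTo_closedBall {U : Set ℂ} (hU : IsOpen U)
    (F : ℕ → ℂ → ℂ) (hF : ∀ n, DifferentiableOn ℂ (F n) U)
    (hb : ∀ n, MapsTo (F n) U (closedBall 0 1)) :
    ∃ (f : ℂ → ℂ) (φ : Filter ℕ), φ.NeBot ∧ φ ≤ atTop ∧ TendstoLocallyUniformlyOn F f φ U := by
  have hlim : ∀ z : ℂ, ∃ w : ℂ, z ∈ U → Tendsto (fun n => F n z) (hyperfilter ℕ) (𝓝 w) := by
    intro z
    by_cases hz : z ∈ U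
    · obtain ⟨w, -, hw⟩ := (isCompact_closedBall (0 : ℂ) 1).ultrafilter_le_nhds
        ((hyperfilter ℕ).map fun n => F n z)
        (le_principal_iff.2 (Filter.mem_map.2 (Filter.Eventually.of_forall fun n => hb n hz)))
      exact ⟨w, fun _ => hw⟩
    · exact ⟨0, fun h => absurd h hz⟩
  choose f hf using hlim
  refine ⟨f, hyperfilter ℕ, inferInstance, Nat.hyperfilter_le_atTop, ?_⟩
  rw [Metric.tendstoLocallyUniformlyOn_iff]
  intro ε hε x hx
  obtain ⟨R, hR, hRU⟩ := Metric.isOpen_iff.1 hU x hx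
  have hLip : ∀ n, ∀ y ∈ ball x R, dist (F n y) (F n x) ≤ 2 / R * dist y x := by
    intro n y hy
    refine Complex.dist_le_div_mul_dist_of_mapsTo_ball ((hF n).mono hRU) ?_ hy
    intro z hz
    have h1 := hb n (hRU hz)
    have h2 := hb n hx
    rw [mem_closedBall] at *
    calc dist (F n z) (F n x) ≤ dist (F n z) 0 + dist (F n x) 0 := dist_triangle_right _ _ _
      _ ≤ 2 := by linarith
  set δ := min R (R * ε / 8) with hδ
  have hδ0 : 0 < δ := by positivity
  have hsmall : ∀ y ∈ ball x δ, 2 / R * dist y x ≤ ε / 4 := by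
    intro y hy
    have : dist y x ≤ R * ε / 8 := (mem_ball.1 hy).le.trans (min_le_right _ _)
    calc 2 / R * dist y x ≤ 2 / R * (R * ε / 8) := by gcongr
      _ = ε / 4 := by field_simp; ring
  refine ⟨ball x δ, mem_nhdsWithin_of_mem_nhds (ball_mem_nhds _ hδ0), ?_⟩
  have hx' := Metric.tendsto_nhds.1 (hf x hx) (ε / 4) (by positivity)
  filter_upwards [hx'] with n hn y hy
  have hyR : y ∈ ball x R := ball_subset_ball (min_le_left _ _) hy
  have h1 := (hLip n y hyR).trans (hsmall y hy)
  have h2 : dist (f y) (f x) ≤ ε / 4 :=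
    le_of_tendsto ((hf y (hRU hyR)).dist (hf x hx))
      (Filter.Eventually.of_forall fun m => (hLip m y hyR).trans (hsmall y hy))
  rw [dist_comm] at h1
  calc dist (f y) (F n y) ≤ dist (f y) (f x) + dist (f x) (F n x) + dist (F n x) (F n y) :=
        dist_triangle4 _ _ _ _
    _ < ε := by rw [dist_comm (f x)]; linarith

/-- The disc automorphism sending `w` to `0`. -/
noncomputable def discMobius (w z : ℂ) : ℂ := (z - w) / (1 - (starRingEnd ℂ) w * z)

theorem one_sub_conj_mul_ne_zero {w z : ℂ} (hw : ‖w‖ < 1) (hz : ‖z‖ < 1) :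
    1 - (starRingEnd ℂ) w * z ≠ 0 := by
  intro h
  have h1 : ‖(starRingEnd ℂ) w * z‖ = 1 := by rw [← sub_eq_zero.1 h, norm_one]
  rw [norm_mul, RCLike.norm_conj] at h1
  nlinarith [norm_nonneg w, norm_nonneg z]

theorem norm_discMobius_lt_one {w z : ℂ} (hw : ‖w‖ < 1) (hz : ‖z‖ < 1) :
    ‖discMobius w z‖ < 1 := by
  have h0 := one_sub_conj_mul_ne_zero hw hz
  rw [discMobius, norm_div, div_lt_one (norm_pos_iff.2 h0)]
  refine lt_of_pow_lt_pow_left₀ 2 (norm_nonneg _) ?_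
  have e1 := Complex.sq_norm (z - w)
  have e2 := Complex.sq_norm (1 - (starRingEnd ℂ) w * z)
  have e3 := Complex.sq_norm z
  have e4 := Complex.sq_norm w
  rw [Complex.normSq_apply] at *
  simp only [Complex.sub_re, Complex.sub_im, Complex.mul_re, Complex.mul_im, Complex.conj_re,
    Complex.conj_im, Complex.one_re, Complex.one_im] at *
  have h1 : ‖z‖ ^ 2 < 1 := by nlinarith [norm_nonneg z]
  have h2 : ‖w‖ ^ 2 < 1 := by nlinarith [norm_nonneg w]
  rw [e3] at h1
  rw [e4] at h2
  rw [e1, e2]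
  nlinarith [mul_pos (sub_pos.2 h1) (sub_pos.2 h2)]

theorem hasDerivAt_discMobius {w z : ℂ} (hw : ‖w‖ < 1) (hz : ‖z‖ < 1) :
    HasDerivAt (discMobius w)
      ((1 - (starRingEnd ℂ) w * w) / (1 - (starRingEnd ℂ) w * z) ^ 2) z := by
  have h0 := one_sub_conj_mul_ne_zero hw hz
  have h1 := ((hasDerivAt_id z).sub_const w).fun_div
    (((hasDerivAt_id z).const_mul ((starRingEnd ℂ) w)).const_sub 1) h0
  have h2 : HasDerivAt (discMobius w) _ z := h1
  refine h2.congr_deriv ?_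
  congr 1
  simp only [id]
  ring

theorem discMobius_injOn {w : ℂ} (hw : ‖w‖ < 1) : InjOn (discMobius w) (ball 0 1) := by
  intro x hx y hy h
  rw [mem_ball_zero_iff] at hx hy
  have h1 := one_sub_conj_mul_ne_zero hw hx
  have h2 := one_sub_conj_mul_ne_zero hw hy
  have h3 := one_sub_conj_mul_ne_zero hw hw
  rw [discMobius, discMobius, div_eq_div_iff h1 h2] at h
  have : (x - y) * (1 - (starRingEnd ℂ) w * w) = 0 := by linear_combination h
  exact sub_eq_zero.1 ((mul_eq_zero.1 this).resolve_right h3)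

/-- Normalised injective holomorphic maps from `U` to the unit disc. -/
structure IsDiscEmbedding (U : Set ℂ) (z₀ : ℂ) (f : ℂ → ℂ) : Prop where
  diff : DifferentiableOn ℂ f U
  mapsTo : MapsTo f U (ball 0 1)
  inj : InjOn f U
  deriv_ne_zero : ∀ z ∈ U, deriv f z ≠ 0
  map_base : f z₀ = 0

theorem isDiscEmbedding_discMobius_comp {U : Set ℂ} (hU : IsOpen U) {z₀ : ℂ} (hz₀ : z₀ ∈ U)
    {f : ℂ → ℂ} (hf : MapsTo f U (ball 0 1)) (hinj : InjOn f U) (hd : DifferentiableOn ℂ f U)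
    (hd0 : ∀ z ∈ U, deriv f z ≠ 0) :
    IsDiscEmbedding U z₀ (fun z => discMobius (f z₀) (f z)) ∧
      ∀ z ∈ U, deriv (fun z => discMobius (f z₀) (f z)) z =
        (1 - (starRingEnd ℂ) (f z₀) * f z₀) / (1 - (starRingEnd ℂ) (f z₀) * f z) ^ 2
          * deriv f z := by
  have h0 : ‖f z₀‖ < 1 := mem_ball_zero_iff.1 (hf hz₀)
  have hD : ∀ z ∈ U, HasDerivAt (fun z => discMobius (f z₀) (f z))
      ((1 - (starRingEnd ℂ) (f z₀) * f z₀) / (1 - (starRingEnd ℂ) (f z₀) * f z) ^ 2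
          * deriv f z) z := fun z hz =>
    (hasDerivAt_discMobius h0 (mem_ball_zero_iff.1 (hf hz))).comp z
      (hd.differentiableAt (hU.mem_nhds hz)).hasDerivAt
  refine ⟨⟨fun z hz => (hD z hz).differentiableAt.differentiableWithinAt, fun z hz => ?_,
    fun x hx y hy h => hinj hx hy (discMobius_injOn h0 (hf hx) (hf hy) h), fun z hz => ?_, ?_⟩,
    fun z hz => (hD z hz).deriv⟩
  · exact mem_ball_zero_iff.2 (norm_discMobius_lt_one h0 (mem_ball_zero_iff.1 (hf hz)))
  · rw [(hD z hz).deriv]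
    exact mul_ne_zero (div_ne_zero (one_sub_conj_mul_ne_zero h0 h0)
      (pow_ne_zero _ (one_sub_conj_mul_ne_zero h0 (mem_ball_zero_iff.1 (hf hz))))) (hd0 z hz)
  · simp [discMobius]

/-- A continuous square root of a holomorphic nonvanishing function is holomorphic. -/
theorem hasDerivAt_of_sq_eq {h p : ℂ → ℂ} {z p' : ℂ} (hc : ContinuousAt h z)
    (hsq : ∀ w, h w ^ 2 = p w) (hp : HasDerivAt p p' z) (h0 : h z ≠ 0) :
    HasDerivAt h (p' / (2 * h z)) z := by
  rw [hasDerivAt_iff_tendsto_slope] at hp ⊢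
  have hc' : Tendsto (fun w => h w + h z) (𝓝[≠] z) (𝓝 (2 * h z)) := by
    rw [two_mul]
    exact (hc.tendsto.mono_left nhdsWithin_le_nhds).add_const _
  have h2 : (2 * h z) ≠ 0 := mul_ne_zero two_ne_zero h0
  refine (hp.div hc' h2).congr' ?_
  filter_upwards [hc'.eventually_ne h2] with w hw
  simp only [Pi.div_apply, slope_def_field, ← hsq]
  field_simp
  ring

/-- The Koebe square root trick. -/
theorem IsDiscEmbedding.exists_norm_deriv_lt {U : Set ℂ} (hU : IsOpen U)
    (hUc : IsSimplyConnected U) {z₀ : ℂ} (hz₀ : z₀ ∈ U) {f : ℂ → ℂ} (hf : IsDiscEmbedding U z₀ f)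
    (hs : ¬ SurjOn f U (ball 0 1)) :
    ∃ k, IsDiscEmbedding U z₀ k ∧ ‖deriv f z₀‖ < ‖deriv k z₀‖ := by
  obtain ⟨w, hw, hwU⟩ := not_subset.1 hs
  rw [mem_ball_zero_iff] at hw
  have hw0 : w ≠ 0 := fun h => hwU ⟨z₀, hz₀, by rw [hf.map_base, h]⟩
  set p : ℂ → ℂ := fun z => discMobius w (f z) with hp
  have hfz : ∀ z ∈ U, ‖f z‖ < 1 := fun z hz => mem_ball_zero_iff.1 (hf.mapsTo hz)
  have hpd : ∀ z ∈ U, HasDerivAt p ((1 - (starRingEnd ℂ) w * w) /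
      (1 - (starRingEnd ℂ) w * f z) ^ 2 * deriv f z) z := fun z hz =>
    (hasDerivAt_discMobius hw (hfz z hz)).comp z
      (hf.diff.differentiableAt (hU.mem_nhds hz)).hasDerivAt
  have hp0 : ∀ z ∈ U, p z ≠ 0 := by
    intro z hz
    refine div_ne_zero (fun h => hwU ⟨z, hz, sub_eq_zero.1 h⟩)
      (one_sub_conj_mul_ne_zero hw (hfz z hz))
  have hpc : ContinuousOn p U := fun z hz => (hpd z hz).continuousAt.continuousWithinAt
  obtain ⟨h, hhc, hsq⟩ := Complex.exists_continuousOn_pow_eq hUc hU hpc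
    (by rintro ⟨z, hz, h⟩; exact hp0 z hz h) two_ne_zero
  have hh0 : ∀ z ∈ U, h z ≠ 0 := fun z hz h0 => hp0 z hz (by rw [← hsq, h0]; simp)
  have hhd : ∀ z ∈ U, HasDerivAt h ((1 - (starRingEnd ℂ) w * w) /
      (1 - (starRingEnd ℂ) w * f z) ^ 2 * deriv f z / (2 * h z)) z := fun z hz =>
    hasDerivAt_of_sq_eq (hhc.continuousAt (hU.mem_nhds hz)) hsq (hpd z hz) (hh0 z hz)
  have hh1 : ∀ z ∈ U, ‖h z‖ < 1 := by
    intro z hz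
    have : ‖p z‖ < 1 := norm_discMobius_lt_one hw (hfz z hz)
    rw [← hsq, norm_pow] at this
    by_contra! hcon
    nlinarith
  have hww := one_sub_conj_mul_ne_zero hw hw
  have hkey := isDiscEmbedding_discMobius_comp hU hz₀ (f := h)
    (fun z hz => mem_ball_zero_iff.2 (hh1 z hz))
    (fun x hx y hy hxy => hf.inj hx hy (discMobius_injOn hw (hf.mapsTo hx) (hf.mapsTo hy)
      (by change p x = p y; rw [← hsq, ← hsq, hxy])))
    (fun z hz => (hhd z hz).differentiableAt.differentiableWithinAt)
    (fun z hz => by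
      rw [(hhd z hz).deriv]
      exact div_ne_zero (mul_ne_zero (div_ne_zero hww (pow_ne_zero _
        (one_sub_conj_mul_ne_zero hw (hfz z hz)))) (hf.deriv_ne_zero z hz))
        (mul_ne_zero two_ne_zero (hh0 z hz)))
  refine ⟨_, hkey.1, ?_⟩
  rw [hkey.2 z₀ hz₀, (hhd z₀ hz₀).deriv]
  set t := ‖h z₀‖ with ht
  have ht0 : 0 < t := norm_pos_iff.2 (hh0 z₀ hz₀)
  have ht1 : t < 1 := hh1 z₀ hz₀
  have hwt : ‖w‖ = t ^ 2 := by
    rw [ht, ← norm_pow, hsq, hp]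
    simp [discMobius, hf.map_base]
  have hc : ∀ x : ℂ, 1 - (starRingEnd ℂ) x * x = ((1 - ‖x‖ ^ 2 : ℝ) : ℂ) := by
    intro x
    rw [mul_comm, Complex.mul_conj, Complex.normSq_eq_norm_sq]
    push_cast
    ring
  rw [hf.map_base, hc w, hc (h z₀), hwt]
  have h1 : 0 < 1 - t ^ 2 := by nlinarith
  have h2 : 0 < 1 - (t ^ 2) ^ 2 := by nlinarith
  simp only [mul_zero, sub_zero, one_pow, div_one, norm_mul, norm_div, norm_pow, Complex.norm_real,
    Real.norm_eq_abs, Complex.norm_ofNat, ← ht, abs_of_pos h1, abs_of_pos h2]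
  have hd := norm_pos_iff.2 (hf.deriv_ne_zero z₀ hz₀)
  have : (1 - t ^ 2) / (1 - t ^ 2) ^ 2 * ((1 - (t ^ 2) ^ 2) * ‖deriv f z₀‖ / (2 * t))
      = (1 + t ^ 2) / (2 * t) * ‖deriv f z₀‖ := by
    field_simp
    ring
  rw [this]
  have : 1 < (1 + t ^ 2) / (2 * t) := by
    rw [lt_div_iff₀ (by positivity)]
    nlinarith [mul_pos (sub_pos.2 ht1) (sub_pos.2 ht1)]
  nlinarith

/-- **Riemann mapping theorem**. -/
theorem exists_isDiscEmbedding_surjOn {U : Set ℂ} (hU : IsOpen U)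
    (hUc : IsSimplyConnected U) (hUb : Bornology.IsBounded U) {z₀ : ℂ} (hz₀ : z₀ ∈ U) :
    ∃ f, IsDiscEmbedding U z₀ f ∧ SurjOn f U (ball 0 1) := by
  have hpre : IsPreconnected U := hUc.isPathConnected.isConnected.isPreconnected
  obtain ⟨f₀, hf₀⟩ : ∃ f, IsDiscEmbedding U z₀ f := by
    obtain ⟨R, hR, hRU⟩ := hUb.subset_ball_lt 0 z₀
    have hR' : (R : ℂ) ≠ 0 := Complex.ofReal_ne_zero.2 hR.ne'
    have hd : ∀ z, HasDerivAt (fun z => (z - z₀) / (R : ℂ)) (1 / (R : ℂ)) z := fun z =>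
      ((hasDerivAt_id z).sub_const z₀).div_const _
    refine ⟨fun z => (z - z₀) / R, fun z _ => (hd z).differentiableAt.differentiableWithinAt,
      fun z hz => ?_, fun x _ y _ h => ?_, fun z _ => ?_, by simp⟩
    · have := mem_ball_iff_norm.1 (hRU hz)
      rw [mem_ball_zero_iff, norm_div, Complex.norm_real, Real.norm_of_nonneg hR.le]
      exact (div_lt_one hR).2 this
    · exact sub_left_injective ((div_left_inj' hR').1 h)
    · rw [(hd z).deriv]
      exact one_div_ne_zero hR'
  set s : Set ℝ := {x | ∃ f, IsDiscEmbedding U z₀ f ∧ ‖deriv f z₀‖ = x} with hs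
  obtain ⟨R, hR, hRU⟩ := Metric.isOpen_iff.1 hU z₀ hz₀
  have hbdd : BddAbove s := by
    refine ⟨1 / R, ?_⟩
    rintro _ ⟨f, hf, rfl⟩
    refine Complex.norm_deriv_le_div_of_mapsTo_ball (hf.diff.mono hRU) (fun z hz => ?_) hR
    rw [hf.map_base]
    exact ball_subset_closedBall (hf.mapsTo (hRU hz))
  obtain ⟨u, -, hu, hus⟩ := exists_seq_tendsto_sSup (S := s) ⟨_, f₀, hf₀, rfl⟩ hbdd
  choose F hF hFu using hus
  obtain ⟨f, φ, hφ, hφle, hlim⟩ := exists_tendstoLocallyUniformlyOn_of_mapsTo_closedBall hU F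
    (fun n => (hF n).diff) (fun n => (hF n).mapsTo.mono_right ball_subset_closedBall)
  have hfd : DifferentiableOn ℂ f U := hlim.differentiableOn
    (Filter.Eventually.of_forall fun n => (hF n).diff) hU
  have hfa : AnalyticOnNhd ℂ f U := hfd.analyticOnNhd hU
  have hdlim := hlim.deriv (Filter.Eventually.of_forall fun n => (hF n).diff) hU
  have hder : ‖deriv f z₀‖ = sSup s := by
    refine tendsto_nhds_unique (hdlim.tendsto_at hz₀).norm ?_
    refine (hu.mono_left hφle).congr fun n => ?_
    exact (hFu n).symm
  have hpos : 0 < sSup s := (norm_pos_iff.2 (hf₀.deriv_ne_zero z₀ hz₀)).trans_le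
    (le_csSup hbdd ⟨f₀, hf₀, rfl⟩)
  have hder0 : deriv f z₀ ≠ 0 := norm_pos_iff.1 (hder ▸ hpos)
  have hbase : f z₀ = 0 := tendsto_nhds_unique (hlim.tendsto_at hz₀)
    (tendsto_const_nhds.congr fun n => ((hF n).map_base).symm)
  have hnc : ∀ c, ∀ b ∈ U, ¬ ∀ᶠ z in 𝓝 b, f z = c := by
    intro c b hb hev
    have := hfa.eqOn_of_preconnected_of_eventuallyEq (g := fun _ => c)
      (fun _ _ => analyticAt_const) hpre hb hev
    refine hder0 ?_
    rw [(this.eventuallyEq_of_mem (hU.mem_nhds hz₀)).deriv_eq, deriv_const]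
  have hle : ∀ z ∈ U, ‖f z‖ ≤ 1 := fun z hz => le_of_tendsto (hlim.tendsto_at hz).norm
    (Filter.Eventually.of_forall fun n => (mem_ball_zero_iff.1 ((hF n).mapsTo hz)).le)
  have hmain : IsDiscEmbedding U z₀ f := by
    refine ⟨hfd, fun z hz => ?_, fun a ha b hb hab => ?_, fun z hz h0 => ?_, hbase⟩
    · rw [mem_ball_zero_iff]
      refine lt_of_le_of_ne (hle z hz) fun h1 => ?_
      have := Complex.eqOn_of_isPreconnected_of_isMaxOn_norm hpre hU hfd hz
        (fun y hy => by simpa [h1] using hle y hy)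
      have h2 := this hz₀
      simp only [hbase, const_apply] at h2
      rw [← h2] at h1
      simp at h1
    · by_contra hne
      have hlima : TendstoLocallyUniformlyOn (fun n z => F n z - F n a)
          (fun z => f z - f a) φ U := by
        have hta := hlim.tendsto_at ha
        rw [Metric.tendstoLocallyUniformlyOn_iff] at hlim ⊢
        intro ε hε x hx
        obtain ⟨t, ht, hev⟩ := hlim (ε / 2) (by positivity) x hx
        refine ⟨t, ht, ?_⟩
        filter_upwards [hev, Metric.tendsto_nhds.1 hta (ε / 2) (by positivity)] with n hn hna y hy
        have := hn y hy
        rw [dist_eq_norm] at *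
        calc ‖f y - f a - (F n y - F n a)‖ = ‖(f y - F n y) + (F n a - f a)‖ := by ring_nf
          _ ≤ _ := norm_add_le _ _
          _ < ε := by linarith
      obtain ⟨V, W, hV, hW, hbV, haW, hVW⟩ := t2_separation (Ne.symm hne)
      have h1 := hlima.eventually_exists_zero hU (fun n => (hF n).diff.sub_const _)
        (hfd.sub_const _) hb (by simp [hab]) (by simpa [sub_eq_zero] using hnc (f a) b hb)
        (inter_mem (hV.mem_nhds hbV) (hU.mem_nhds hb))
      obtain ⟨n, z, ⟨hzV, hzU⟩, hz⟩ := h1.exists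
      have := (hF n).inj hzU ha (sub_eq_zero.1 hz)
      exact disjoint_left.1 hVW hzV (this ▸ haW)
    · have hda : AnalyticOnNhd ℂ (deriv f) U := hfa.deriv
      have h1 := hdlim.eventually_exists_zero hU
        (fun n => ((hF n).diff.analyticOnNhd hU).deriv.differentiableOn)
        hda.differentiableOn hz h0
        (fun hev => hder0 (hda.eqOn_zero_of_preconnected_of_eventuallyEq_zero hpre hz hev hz₀))
        (hU.mem_nhds hz)
      obtain ⟨n, x, hx, h⟩ := h1.exists
      exact (hF n).deriv_ne_zero x hx h
  refine ⟨f, hmain, ?_⟩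
  by_contra hcon
  obtain ⟨k, hk, hlt⟩ := hmain.exists_norm_deriv_lt hU hUc hz₀ hcon
  exact absurd (le_csSup hbdd ⟨k, hk, rfl⟩) (not_le.2 (hder ▸ hlt))

theorem volume_image_eq_lintegral_deriv_sq {U : Set ℂ} (hU : IsOpen U) {f : ℂ → ℂ}
    (hf : DifferentiableOn ℂ f U) (hinj : InjOn f U) :
    ∫⁻ z in U, ENNReal.ofReal (‖deriv f z‖ ^ 2) = volume (f '' U) := by
  have h := lintegral_abs_det_fderiv_eq_addHaar_image volume hU.measurableSet
    (f' := fun z => (ContinuousLinearMap.toSpanSingleton ℂ (deriv f z)).restrictScalars ℝ)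
    (fun z hz => ((hf.differentiableAt (hU.mem_nhds hz)).hasDerivAt.hasFDerivAt.restrictScalars
      ℝ).hasFDerivWithinAt) hinj
  rw [← h]
  refine lintegral_congr fun z => ?_
  congr 1
  simp [ContinuousLinearMap.det, LinearMap.det_restrictScalars, Algebra.norm_complex_eq,
    Complex.normSq_eq_norm_sq]

theorem exists_radius_mul_le {I : ℝ → ENNReal} {δ c : ℝ} (hδ : 0 < δ) (hc : 0 < c)
    (hI : ∫⁻ r in Ioi (0 : ℝ), I r ≠ ⊤) :
    ∃ r ∈ Ioo 0 δ, ENNReal.ofReal r * I r ≤ ENNReal.ofReal c := by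
  by_contra! hcon
  have h1 : ∀ r ∈ Ioo 0 δ, ENNReal.ofReal (c * r⁻¹) ≤ I r := by
    intro r hr
    have h2 := (hcon r hr).le
    rw [ENNReal.ofReal_mul hc.le, ENNReal.ofReal_inv_of_pos hr.1, ← div_eq_mul_inv]
    refine ENNReal.div_le_of_le_mul' h2
  have h2 : ∫⁻ r in Ioo 0 δ, ENNReal.ofReal (c * r⁻¹) < ⊤ := by
    refine lt_of_le_of_lt ?_ (lt_top_iff_ne_top.2 hI)
    exact (setLIntegral_mono' measurableSet_Ioo h1).trans
      (lintegral_mono_set Ioo_subset_Ioi_self)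
  have h3 : IntegrableOn (fun r : ℝ => c * r⁻¹) (Ioo 0 δ) := by
    refine ⟨(measurable_inv.const_mul c).aestronglyMeasurable, ?_⟩
    rw [hasFiniteIntegral_iff_ofReal]
    · exact h2
    · filter_upwards [ae_restrict_mem measurableSet_Ioo] with r hr
      have := hr.1
      simp only [Pi.zero_apply]
      positivity
  have h4 : IntegrableOn (fun r : ℝ => r⁻¹) (Ioo 0 δ) := by
    have := h3.const_mul c⁻¹
    refine this.congr (Eventually.of_forall fun r => ?_)
    simp only [← mul_assoc, inv_mul_cancel₀ hc.ne', one_mul]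
  have h5 : IntervalIntegrable (fun r : ℝ => r⁻¹) volume 0 δ :=
    (intervalIntegrable_iff_integrableOn_Ioo_of_le hδ.le).2 h4
  rcases intervalIntegrable_inv_iff.1 h5 with h | h
  · exact hδ.ne h
  · exact h left_mem_uIcc

/-- The length–area principle, in a form bounding the linear projections of the images of
small circles under an injective holomorphic map. -/
theorem exists_sphere_projection_le {U : Set ℂ} (hU : IsOpen U) {f : ℂ → ℂ}
    (hf : DifferentiableOn ℂ f U) (hinj : InjOn f U) (hb : Bornology.IsBounded (f '' U)) (p : ℂ)
    {δ ε : ℝ} (hδ : 0 < δ) (hε : 0 < ε) :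
    ∃ r ∈ Ioo 0 δ, ∀ ℓ : ℂ →L[ℝ] ℝ, ‖ℓ‖ ≤ 1 →
      volume (ℓ '' (f '' (U ∩ sphere p r))) ≤ ENNReal.ofReal ε := by
  set G : ℂ → ENNReal := U.indicator fun z => ENNReal.ofReal (‖deriv f z‖ ^ 2) with hG
  have hGm : Measurable G :=
    (((measurable_deriv f).norm.pow_const 2).ennreal_ofReal).indicator hU.measurableSet
  set E : ℝ × ℝ → ℂ := fun q => p + Complex.polarCoord.symm q with hE
  have hEc : Continuous E := by
    simp only [hE, Complex.polarCoord_symm_apply]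
    fun_prop
  have hfin : ∫⁻ r in Ioi (0 : ℝ), ENNReal.ofReal r *
      ∫⁻ θ in Ioo (-Real.pi) Real.pi, G (E (r, θ)) ≠ ⊤ := by
    have h1 : ∫⁻ z, G (p + z) = volume (f '' U) := by
      rw [lintegral_add_left_eq_self (fun z => G z) p, lintegral_indicator hU.measurableSet,
        volume_image_eq_lintegral_deriv_sq hU hf hinj]
    have h2 := Complex.lintegral_comp_polarCoord_symm fun z => G (p + z)
    rw [h1, polarCoord_target, Measure.volume_eq_prod, setLIntegral_prod] at h2
    · have h3 : ∀ r : ℝ, ENNReal.ofReal r * ∫⁻ θ in Ioo (-Real.pi) Real.pi, G (E (r, θ)) =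
          ∫⁻ θ in Ioo (-Real.pi) Real.pi, ENNReal.ofReal r • G (E (r, θ)) := by
        intro r
        rw [← lintegral_const_mul]
        · rfl
        · exact hGm.comp (hEc.measurable.comp (by fun_prop))
      simp only [h3]
      rw [h2]
      exact hb.measure_lt_top.ne
    · refine Measurable.aemeasurable ?_
      exact (measurable_fst.ennreal_ofReal).mul (hGm.comp hEc.measurable)
  set η : ℝ := ε / (4 * Real.pi) with hη
  have hηpos : 0 < η := by have := Real.pi_pos; positivity
  obtain ⟨r, hr, hrI⟩ := exists_radius_mul_le (c := η * (ε / 2)) hδ (by positivity) hfin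
  refine ⟨r, hr, fun ℓ hℓ => ?_⟩
  set F : ℝ → ℂ := fun θ => E (r, θ) with hF
  have hFc : Continuous F := hEc.comp (by fun_prop)
  set T : Set ℝ := Ioo (-Real.pi) Real.pi ∩ F ⁻¹' U with hT
  have hTm : MeasurableSet T := measurableSet_Ioo.inter (hU.preimage hFc).measurableSet
  have hFd : ∀ θ, HasDerivAt F (r * (-Real.sin θ + Real.cos θ * Complex.I)) θ := by
    intro θ
    have h1 : HasDerivAt (fun θ : ℝ => ((Real.cos θ : ℝ) : ℂ)) _ θ :=
      (Real.hasDerivAt_cos θ).ofReal_comp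
    have h2 : HasDerivAt (fun θ : ℝ => ((Real.sin θ : ℝ) : ℂ)) _ θ :=
      (Real.hasDerivAt_sin θ).ofReal_comp
    have h3 := ((h1.add (h2.mul_const Complex.I)).const_mul (r : ℂ)).const_add p
    simp only [hF, hE, Complex.polarCoord_symm_apply]
    refine h3.congr_deriv ?_
    push_cast
    rfl
  have hsub : ℓ '' (f '' (U ∩ sphere p r)) ⊆ ((fun θ => ℓ (f (F θ))) '' T) ∪ {ℓ (f (p - r))} := by
    rintro _ ⟨_, ⟨z, ⟨hzU, hz⟩, rfl⟩, rfl⟩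
    have hn : ‖z - p‖ = r := by rwa [mem_sphere, dist_eq_norm] at hz
    have hz' : z = F (z - p).arg := by
      have := Complex.norm_mul_cos_add_sin_mul_I (z - p)
      simp only [hF, hE, Complex.polarCoord_symm_apply]
      rw [hn] at this
      push_cast
      rw [this]
      ring
    rcases (Complex.arg_le_pi (z - p)).eq_or_lt with h | h
    · right
      rw [h] at hz'
      simp only [hF, hE, Complex.polarCoord_symm_apply, Real.cos_pi, Real.sin_pi] at hz'
      rw [hz']
      simp [sub_eq_add_neg]
    · left
      refine ⟨(z - p).arg, ⟨⟨Complex.neg_pi_lt_arg _, h⟩, ?_⟩, ?_⟩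
      · rw [mem_preimage, ← hz']; exact hzU
      · simp only; rw [← hz']
  have hder : ∀ θ ∈ T, HasDerivAt (fun θ => ℓ (f (F θ)))
      (ℓ (deriv f (F θ) * (r * (-Real.sin θ + Real.cos θ * Complex.I)))) θ := by
    intro θ hθ
    have h1 := (hf.differentiableAt (hU.mem_nhds hθ.2)).hasDerivAt
    have h2 : HasDerivAt (fun θ => f (F θ)) _ θ := h1.comp_of_eq θ (hFd θ) rfl
    exact ℓ.hasFDerivAt.comp_hasDerivAt θ h2
  have hnorm : ∀ θ : ℝ, ‖(r : ℂ) * (-Real.sin θ + Real.cos θ * Complex.I)‖ = r := by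
    intro θ
    have : (-Real.sin θ + Real.cos θ * Complex.I : ℂ) =
        (Real.cos θ + Real.sin θ * Complex.I) * Complex.I := by
      linear_combination (-Real.sin θ : ℂ) * Complex.I_sq
    rw [this, norm_mul, norm_mul, Complex.norm_I, mul_one, Complex.norm_real,
      Real.norm_of_nonneg hr.1.le]
    have h2 := Complex.norm_exp_ofReal_mul_I θ
    rw [Complex.exp_mul_I] at h2
    push_cast
    rw [h2, mul_one]
  calc volume (ℓ '' (f '' (U ∩ sphere p r)))
      ≤ volume ((fun θ => ℓ (f (F θ))) '' T) := by
        refine (measure_mono hsub).trans ((measure_union_le _ _).trans ?_)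
        simp
    _ ≤ ∫⁻ θ in T, ENNReal.ofReal
          |ℓ (deriv f (F θ) * (r * (-Real.sin θ + Real.cos θ * Complex.I)))| := by
        have := addHaar_image_le_lintegral_abs_det_fderiv (volume : Measure ℝ) hTm
          (fun θ hθ => (hder θ hθ).hasFDerivAt.hasFDerivWithinAt)
        simpa only [ContinuousLinearMap.det_toSpanSingleton] using this
    _ ≤ ∫⁻ θ in Ioo (-Real.pi) Real.pi, (ENNReal.ofReal η +
          ENNReal.ofReal (η⁻¹ * r ^ 2) * G (F θ)) := by
        refine (setLIntegral_mono' hTm fun θ hθ => ?_).trans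
          (lintegral_mono_set inter_subset_left)
        simp only [hG, indicator_of_mem (show F θ ∈ U from hθ.2)]
        rw [← ENNReal.ofReal_mul (by positivity), ← ENNReal.ofReal_add (by positivity)
          (by positivity)]
        refine ENNReal.ofReal_le_ofReal ?_
        have h1 := ℓ.le_of_opNorm_le hℓ
          (deriv f (F θ) * (r * (-Real.sin θ + Real.cos θ * Complex.I)))
        rw [one_mul, norm_mul, hnorm, Real.norm_eq_abs] at h1
        refine h1.trans ?_
        set a := ‖deriv f (F θ)‖
        have h2 : η * (a * r) ≤ η * (η + η⁻¹ * r ^ 2 * a ^ 2) := by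
          have : η * (η + η⁻¹ * r ^ 2 * a ^ 2) = η ^ 2 + (a * r) ^ 2 := by
            field_simp
          rw [this]
          nlinarith [sq_nonneg (η - a * r), sq_nonneg (a * r), sq_nonneg η]
        exact le_of_mul_le_mul_left h2 hηpos
    _ = ENNReal.ofReal η * ENNReal.ofReal (2 * Real.pi) + ENNReal.ofReal η⁻¹ *
          (ENNReal.ofReal r * (ENNReal.ofReal r *
            ∫⁻ θ in Ioo (-Real.pi) Real.pi, G (E (r, θ)))) := by
        have hm : Measurable fun θ => G (F θ) := hGm.comp hFc.measurable
        rw [lintegral_add_left measurable_const, lintegral_const_mul _ hm,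
          setLIntegral_const, Real.volume_Ioo, ENNReal.ofReal_mul (by positivity), pow_two,
          ENNReal.ofReal_mul hr.1.le]
        simp only [hF, mul_assoc]
        rw [show Real.pi - -Real.pi = 2 * Real.pi by ring]
    _ ≤ ENNReal.ofReal η * ENNReal.ofReal (2 * Real.pi) + ENNReal.ofReal η⁻¹ *
          ENNReal.ofReal (η * (ε / 2)) := by
        gcongr
    _ = ENNReal.ofReal ε := by
        rw [← ENNReal.ofReal_mul hηpos.le, ← ENNReal.ofReal_mul (by positivity),
          ← ENNReal.ofReal_add (by positivity) (by positivity)]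
        congr 1
        have := Real.pi_pos
        rw [hη]
        field_simp
        norm_num

theorem IsPreconnected.abs_sub_le_of_volume_le {S : Set ℝ} (hS : IsPreconnected S) {x y ε : ℝ}
    (hε : 0 ≤ ε) (hx : x ∈ S) (hy : y ∈ S) (h : volume S ≤ ENNReal.ofReal ε) : |x - y| ≤ ε := by
  have h1 : volume (uIcc y x) ≤ ENNReal.ofReal ε :=
    (measure_mono (hS.ordConnected.uIcc_subset hy hx)).trans h
  rwa [Real.volume_interval, ENNReal.ofReal_le_ofReal_iff hε] at h1

theorem isPreconnected_ball_inter_sphere {ζ : ℂ} (hζ : ‖ζ‖ = 1) {r : ℝ} (hr : 0 < r) :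
    IsPreconnected (ball (0 : ℂ) 1 ∩ sphere ζ r) := by
  set I : Set ℝ := {s : ℝ | s ^ 2 < 1 ∧ r / 2 < √(1 - s ^ 2)} with hI
  have hI' : IsPreconnected I := by
    have : I = Ioo (-√(1 - (r / 2) ^ 2)) (√(1 - (r / 2) ^ 2)) := by
      ext s
      rw [hI, mem_ofPred_eq, Real.lt_sqrt (by positivity), mem_Ioo, ← Real.sq_lt]
      constructor
      · rintro ⟨h1, h2⟩; linarith
      · intro h; exact ⟨by nlinarith [sq_nonneg r], by linarith⟩
    rw [this]
    exact isPreconnected_Ioo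
  set γ : ℝ → ℂ := fun s => ζ * (1 - r * ((√(1 - s ^ 2) : ℝ) + s * Complex.I)) with hγ
  have hγc : Continuous γ := by fun_prop
  have hζ0 : ζ ≠ 0 := norm_ne_zero_iff.1 (by rw [hζ]; exact one_ne_zero)
  have key : ball (0 : ℂ) 1 ∩ sphere ζ r = γ '' I := by
    ext z
    constructor
    · rintro ⟨hz, hz'⟩
      rw [mem_ball_zero_iff] at hz
      rw [mem_sphere, dist_eq_norm] at hz'
      set v : ℂ := (1 - z / ζ) / r with hv
      have hrv : (r : ℂ) * v = 1 - z / ζ := by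
        have : (r : ℂ) ≠ 0 := by exact_mod_cast hr.ne'
        rw [hv]; field_simp
      have hzv : z = ζ * (1 - r * v) := by rw [hrv]; field_simp; ring
      have hvn : ‖v‖ = 1 := by
        have h1 : ‖z - ζ‖ = r * ‖v‖ := by
          rw [hzv, show ζ * (1 - r * v) - ζ = -(ζ * r * v) by ring, norm_neg, norm_mul, norm_mul,
            hζ, Complex.norm_real, Real.norm_of_nonneg hr.le, one_mul]
        rw [hz'] at h1
        have : r * (‖v‖ - 1) = 0 := by linarith
        rcases mul_eq_zero.1 this with h | h
        · exact absurd h hr.ne'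
        · linarith
      have hvs : v.re ^ 2 + v.im ^ 2 = 1 := by
        have := Complex.sq_norm v
        rw [hvn, Complex.normSq_apply] at this
        linarith
      have h2 : ‖1 - r * v‖ < 1 := by rwa [hzv, norm_mul, hζ, one_mul] at hz
      have h3 : r / 2 < v.re := by
        have h4 := Complex.sq_norm (1 - r * v)
        rw [Complex.normSq_apply] at h4
        simp only [Complex.sub_re, Complex.sub_im, Complex.one_re, Complex.one_im,
          Complex.re_ofReal_mul, Complex.im_ofReal_mul] at h4
        have h5 : ‖1 - r * v‖ ^ 2 < 1 := by nlinarith [norm_nonneg (1 - r * v)]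
        have h6 : r * (r - 2 * v.re) < 0 := by
          have : r * (r - 2 * v.re) = ‖1 - r * v‖ ^ 2 - 1 := by
            rw [h4]; linear_combination (-r ^ 2) * hvs
          linarith
        have := neg_of_mul_neg_right h6 hr.le
        linarith
      have h4 : √(1 - v.im ^ 2) = v.re := by
        rw [show 1 - v.im ^ 2 = v.re ^ 2 by linarith, Real.sqrt_sq (by linarith)]
      refine ⟨v.im, ⟨by nlinarith, by rwa [h4]⟩, ?_⟩
      simp only [hγ]
      rw [h4, Complex.re_add_im, ← hzv]
    · rintro ⟨s, ⟨hs1, hs2⟩, rfl⟩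
      set c := √(1 - s ^ 2) with hc
      have hcs : c ^ 2 = 1 - s ^ 2 := Real.sq_sqrt (by linarith)
      have hvn : ‖((c : ℂ) + s * Complex.I)‖ = 1 := by
        have := Complex.sq_norm ((c : ℂ) + s * Complex.I)
        rw [Complex.normSq_add_mul_I, hcs] at this
        have h1 : ‖((c : ℂ) + s * Complex.I)‖ ^ 2 = 1 := by linarith
        exact (pow_eq_one_iff_of_nonneg (norm_nonneg _) two_ne_zero).1 h1
      constructor
      · rw [mem_ball_zero_iff]
        simp only [hγ]
        rw [norm_mul, hζ, one_mul]
        refine lt_of_pow_lt_pow_left₀ 2 zero_le_one ?_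
        rw [Complex.sq_norm, show (1 - (r : ℂ) * (c + s * Complex.I)) =
          ((1 - r * c : ℝ) : ℂ) + ((-(r * s) : ℝ) : ℂ) * Complex.I by push_cast; ring,
          Complex.normSq_add_mul_I]
        have h1 : (1 - r * c) ^ 2 + (-(r * s)) ^ 2 = 1 - r * (2 * c - r) := by
          linear_combination r ^ 2 * hcs
        have h2 : 0 < r * (2 * c - r) := mul_pos hr (by linarith)
        linarith
      · rw [mem_sphere, dist_eq_norm]
        simp only [hγ]
        rw [show ζ * (1 - (r : ℂ) * (c + s * Complex.I)) - ζ = -(ζ * (r * (c + s * Complex.I)))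
          by ring, norm_neg, norm_mul, norm_mul, hζ, hvn, Complex.norm_real,
          Real.norm_of_nonneg hr.le]
        ring
  rw [key]
  exact hI'.image γ hγc.continuousOn

/-- The arc cut out of the unit disc by a small circle centred on the boundary contains points
close to the unit circle. -/
theorem exists_mem_ball_inter_sphere {ζ : ℂ} (hζ : ‖ζ‖ = 1) {r ρ : ℝ} (hr : 0 < r) (hr1 : r < 1)
    (hρ : ρ < 1) : ∃ z ∈ ball (0 : ℂ) 1 ∩ sphere ζ r, ρ < ‖z‖ := by
  obtain ⟨s, hs, hs1⟩ := exists_between (max_lt hρ (show 1 - r < 1 by linarith))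
  have hs2 : ρ < s := (le_max_left _ _).trans_lt hs
  have hs3 : 1 - r < s := (le_max_right _ _).trans_lt hs
  set c : ℝ := (1 + r ^ 2 - s ^ 2) / (2 * r) with hc
  have hrc : 2 * r * c = 1 + r ^ 2 - s ^ 2 := by rw [hc]; field_simp
  have hc0 : 0 < c := by rw [hc]; apply div_pos <;> nlinarith
  have hc1 : c ≤ 1 := by rw [hc, div_le_one (by positivity)]; nlinarith
  set d : ℝ := √(1 - c ^ 2) with hd
  have hd2 : d ^ 2 = 1 - c ^ 2 := Real.sq_sqrt (by nlinarith)
  set z : ℂ := ζ * (1 - r * (c + d * Complex.I)) with hz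
  have hzn : ‖z‖ = s := by
    rw [hz, norm_mul, hζ, one_mul]
    refine (pow_left_inj₀ (norm_nonneg _) (by linarith) two_ne_zero).1 ?_
    rw [Complex.sq_norm, show (1 - (r : ℂ) * (c + d * Complex.I)) =
          ((1 - r * c : ℝ) : ℂ) + ((-(r * d) : ℝ) : ℂ) * Complex.I by push_cast; ring,
          Complex.normSq_add_mul_I]
    nlinarith
  refine ⟨z, ⟨by rw [mem_ball_zero_iff, hzn]; exact hs1, ?_⟩, by rw [hzn]; exact hs2⟩
  rw [mem_sphere, dist_eq_norm, show z - ζ = -(ζ * (r * (c + d * Complex.I))) by rw [hz]; ring,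
    norm_neg, norm_mul, norm_mul, hζ, Complex.norm_real, Real.norm_of_nonneg hr.le, one_mul]
  have : ‖(c : ℂ) + d * Complex.I‖ = 1 := by
    refine (pow_left_inj₀ (norm_nonneg _) zero_le_one two_ne_zero).1 ?_
    rw [Complex.sq_norm, Complex.normSq_add_mul_I]
    linarith
  rw [this, mul_one]

theorem norm_sub_le_of_mem_cap {u z : ℂ} (hu : ‖u‖ = 1) (hz : ‖z‖ ≤ 1) {ε : ℝ} (hε : 0 ≤ ε)
    (h : 1 - 2 * ε ^ 2 ≤ inner ℝ u z) : ‖z - u‖ ≤ 2 * ε := by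
  refine (pow_le_pow_iff_left₀ (norm_nonneg _) (by positivity) two_ne_zero).1 ?_
  rw [norm_sub_sq_real, hu, real_inner_comm]
  nlinarith [norm_nonneg z]

/-- Boundary oscillation of `h ∘ φ`, where `φ` is a bounded injective holomorphic map on the disc
and `h` is continuous, provided `h ∘ φ` is a self-homeomorphism of the disc fixing the origin. -/
theorem exists_ball_dist_le_of_conformal {φ h ψ : ℂ → ℂ} (hφ : DifferentiableOn ℂ φ (ball 0 1))
    (hφi : InjOn φ (ball 0 1)) (hφb : Bornology.IsBounded (φ '' ball 0 1)) (hh : Continuous h)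
    (hθ : ∀ w ∈ ball (0 : ℂ) 1, h (φ w) ∈ ball (0 : ℂ) 1)
    (hψ : ContinuousOn ψ (ball 0 1)) (hψm : MapsTo ψ (ball 0 1) (ball 0 1))
    (hψθ : ∀ w ∈ ball (0 : ℂ) 1, ψ (h (φ w)) = w)
    (hθψ : ∀ z ∈ ball (0 : ℂ) 1, h (φ (ψ z)) = z) (h0 : ψ 0 = 0)
    {ζ : ℂ} (hζ : ‖ζ‖ = 1) {ε : ℝ} (hε : 0 < ε) :
    ∃ r > 0, ∀ w ∈ ball (0 : ℂ) 1 ∩ ball ζ r, ∀ w' ∈ ball (0 : ℂ) 1 ∩ ball ζ r,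
      dist (h (φ w)) (h (φ w')) ≤ ε := by
  set e : ℝ := min (ε / 4) (1 / 2) with he
  have he0 : 0 < e := by positivity
  have he1 : e ≤ ε / 4 := min_le_left _ _
  have he2 : e ≤ 1 / 2 := min_le_right _ _
  have he3 : e ^ 2 ≤ 1 / 4 := by nlinarith
  obtain ⟨R, hR⟩ := hφb.subset_closedBall 0
  obtain ⟨δ, hδ, hδh⟩ := Metric.uniformContinuousOn_iff.1
    ((isCompact_closedBall (0 : ℂ) R).uniformContinuousOn_of_continuous hh.continuousOn)
    (e ^ 2) (by positivity)
  obtain ⟨r, hr, hrℓ⟩ := exists_sphere_projection_le isOpen_ball hφ hφi hφb ζ one_pos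
    (show 0 < δ / 4 by positivity)
  set A : Set ℂ := ball (0 : ℂ) 1 ∩ sphere ζ r with hA
  have hAc : IsPreconnected (φ '' A) :=
    (isPreconnected_ball_inter_sphere hζ hr.1).image φ (hφ.continuousOn.mono inter_subset_left)
  have hAd : ∀ a ∈ A, ∀ b ∈ A, dist (h (φ a)) (h (φ b)) < e ^ 2 := by
    intro a ha b hb
    refine hδh _ (hR (mem_image_of_mem φ ha.1)) _ (hR (mem_image_of_mem φ hb.1)) ?_
    have h1 : |(φ a).re - (φ b).re| ≤ δ / 4 :=
      (hAc.image Complex.re Complex.continuous_re.continuousOn).abs_sub_le_of_volume_le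
        (by positivity) (mem_image_of_mem _ (mem_image_of_mem _ ha))
        (mem_image_of_mem _ (mem_image_of_mem _ hb)) (hrℓ Complex.reCLM Complex.reCLM_norm.le)
    have h2 : |(φ a).im - (φ b).im| ≤ δ / 4 :=
      (hAc.image Complex.im Complex.continuous_im.continuousOn).abs_sub_le_of_volume_le
        (by positivity) (mem_image_of_mem _ (mem_image_of_mem _ ha))
        (mem_image_of_mem _ (mem_image_of_mem _ hb)) (hrℓ Complex.imCLM Complex.imCLM_norm.le)
    rw [dist_eq_norm]
    have := Complex.norm_le_abs_re_add_abs_im (φ a - φ b)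
    simp only [Complex.sub_re, Complex.sub_im] at this
    linarith
  obtain ⟨ρ, hρ, hρψ⟩ : ∃ ρ < 1, ∀ z ∈ closedBall (0 : ℂ) (1 - e ^ 2), ‖ψ z‖ ≤ ρ := by
    have hsub : closedBall (0 : ℂ) (1 - e ^ 2) ⊆ ball 0 1 :=
      closedBall_subset_ball (by nlinarith)
    obtain ⟨z₀, hz₀, hmax⟩ := (isCompact_closedBall (0 : ℂ) (1 - e ^ 2)).exists_isMaxOn
      ⟨0, by rw [mem_closedBall, dist_self]; linarith⟩ (hψ.mono hsub).norm
    exact ⟨‖ψ z₀‖, mem_ball_zero_iff.1 (hψm (hsub hz₀)), fun z hz => hmax hz⟩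
  obtain ⟨a, haA, haρ⟩ := exists_mem_ball_inter_sphere hζ hr.1 hr.2 hρ
  set t : ℂ := h (φ a) with ht
  have ht1 : 1 - e ^ 2 < ‖t‖ := by
    by_contra! hcon
    have := hρψ t (mem_closedBall_zero_iff.2 hcon)
    rw [hψθ a haA.1] at this
    linarith
  have htpos : 0 < ‖t‖ := by linarith
  set u : ℂ := t / ‖t‖ with hu
  have hun : ‖u‖ = 1 := by
    rw [hu, norm_div, Complex.norm_real, norm_norm, div_self htpos.ne']
  have hut : inner ℝ u t = ‖t‖ := by
    have h1 : t = (‖t‖ : ℝ) • u := by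
      have : (‖t‖ : ℂ) ≠ 0 := by exact_mod_cast htpos.ne'
      rw [hu, Complex.real_smul]
      field_simp
    conv_lhs => rw [h1]
    rw [real_inner_smul_right, real_inner_self_eq_norm_sq, hun]
    ring
  have hcapA : ∀ b ∈ A, 1 - 2 * e ^ 2 ≤ inner ℝ u (h (φ b)) := by
    intro b hb
    have h1 := (hAd a haA b hb).le
    rw [dist_eq_norm] at h1
    have h2 : inner ℝ u (t - h (φ b)) ≤ ‖u‖ * ‖t - h (φ b)‖ := real_inner_le_norm _ _
    rw [hun, one_mul, inner_sub_right, hut] at h2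
    linarith
  set W : Set ℂ := ball 0 1 ∩ {z | inner ℝ u z < 1 - 2 * e ^ 2} with hW
  have hWc : Convex ℝ W :=
    (convex_ball 0 1).inter (convex_halfSpace_lt (innerₛₗ ℝ u).isLinear _)
  have h0W : (0 : ℂ) ∈ W := by
    refine ⟨mem_ball_self one_pos, ?_⟩
    rw [mem_ofPred_eq, inner_zero_right]
    by_contra! hcon
    have h1 := (hθ a haA.1)
    nlinarith
  have hcap : ∀ w ∈ ball (0 : ℂ) 1 ∩ ball ζ r, 1 - 2 * e ^ 2 ≤ inner ℝ u (h (φ w)) := by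
    intro w hw
    by_contra! hcon
    have hwW : h (φ w) ∈ W := ⟨hθ w hw.1, hcon⟩
    have hpre : IsPreconnected (ψ '' W) :=
      hWc.isPreconnected.image ψ (hψ.mono inter_subset_left)
    have h1 : w ∈ ψ '' W := ⟨_, hwW, hψθ w hw.1⟩
    have h2 : (0 : ℂ) ∈ ψ '' W := ⟨0, h0W, h0⟩
    have h3 := hpre.intermediate_value h1 h2 (f := fun z => dist z ζ) (by fun_prop)
    obtain ⟨y, ⟨x, hx, rfl⟩, hy⟩ := h3 (show r ∈ Icc (dist w ζ) (dist 0 ζ) from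
      ⟨(mem_ball.1 hw.2).le, by rw [dist_zero_left, hζ]; exact hr.2.le⟩)
    have h4 := hcapA (ψ x) ⟨hψm hx.1, hy⟩
    rw [hθψ x hx.1] at h4
    exact absurd hx.2 (not_lt.2 h4)
  refine ⟨r, hr.1, fun w hw w' hw' => ?_⟩
  have h1 := norm_sub_le_of_mem_cap hun (mem_ball_zero_iff.1 (hθ w hw.1)).le he0.le (hcap w hw)
  have h2 := norm_sub_le_of_mem_cap hun (mem_ball_zero_iff.1 (hθ w' hw'.1)).le he0.le (hcap w' hw')
  have h3 := dist_triangle_right (h (φ w)) (h (φ w')) u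
  rw [dist_eq_norm (h (φ w)) u, dist_eq_norm (h (φ w')) u] at h3
  linarith

/-- Boundary oscillation of `f ∘ g`, where `f` maps `Ω` conformally onto the disc and `g` is
continuous with `g '' ball 0 1 = Ω`. -/
theorem exists_ball_dist_le_of_conformal_symm {Ω : Set ℂ} (hΩ : IsOpen Ω) {f φ g : ℂ → ℂ}
    (hf : DifferentiableOn ℂ f Ω) (hfi : InjOn f Ω) (hfm : MapsTo f Ω (ball 0 1))
    (hφ : ContinuousOn φ (ball 0 1)) (hφm : MapsTo φ (ball 0 1) Ω)
    (hfφ : ∀ w ∈ ball (0 : ℂ) 1, f (φ w) = w) (hφf : ∀ z ∈ Ω, φ (f z) = z)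
    (hg : Continuous g) (hgm : MapsTo g (ball 0 1) Ω) {p : ℂ} (hp : g p ∉ Ω)
    {ε : ℝ} (hε : 0 < ε) :
    ∃ r > 0, ∀ z ∈ ball (0 : ℂ) 1 ∩ ball p r, ∀ z' ∈ ball (0 : ℂ) 1 ∩ ball p r,
      dist (f (g z)) (f (g z')) ≤ ε := by
  set e : ℝ := min (ε / 5) (1 / 8) with he
  have he0 : 0 < e := by positivity
  have he1 : e ≤ ε / 5 := min_le_left _ _
  have he2 : e ≤ 1 / 8 := min_le_right _ _
  have hsub : closedBall (0 : ℂ) (3 / 4) ⊆ ball 0 1 := closedBall_subset_ball (by norm_num)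
  have hK : IsClosed (φ '' closedBall 0 (3 / 4)) :=
    ((isCompact_closedBall _ _).image_of_continuousOn (hφ.mono hsub)).isClosed
  have hpK : g p ∈ (φ '' closedBall 0 (3 / 4))ᶜ := by
    rintro ⟨w, hw, hwp⟩
    exact hp (hwp ▸ hφm (hsub hw))
  obtain ⟨δ, hδ, hδK⟩ := Metric.isOpen_iff.1 hK.isOpen_compl _ hpK
  obtain ⟨r, hr, hrℓ⟩ := exists_sphere_projection_le hΩ hf hfi
    (isBounded_ball.subset (image_subset_iff.2 hfm)) (g p) hδ he0
  obtain ⟨η, hη, hηg⟩ := Metric.continuousAt_iff.1 (hg.continuousAt (x := p)) r hr.1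
  set W : Set ℂ := ball (0 : ℂ) 1 ∩ ball p η with hW
  have hWc : IsPreconnected ((fun z => f (g z)) '' W) := by
    refine (((convex_ball 0 1).inter (convex_ball p η)).isPreconnected).image _ ?_
    exact hf.continuousOn.comp hg.continuousOn fun z hz => hgm hz.1
  have hseg : ∀ z ∈ W, ∀ c ∈ closedBall (0 : ℂ) (3 / 4),
      ∃ y ∈ segment ℝ (f (g z)) c, y ∈ f '' (Ω ∩ sphere (g p) r) := by
    intro z hz c hc
    have hs : segment ℝ (f (g z)) c ⊆ ball 0 1 :=
      (convex_ball 0 1).segment_subset (hfm (hgm hz.1)) (hsub hc)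
    have h1 := (convex_segment (𝕜 := ℝ) (f (g z)) c).isPreconnected.intermediate_value
      (left_mem_segment ℝ _ _) (right_mem_segment ℝ _ _) (f := fun y => dist (φ y) (g p))
      (continuous_dist.comp_continuousOn ((hφ.mono hs).prodMk continuousOn_const))
    obtain ⟨y, hy, hyr⟩ := h1 (show r ∈ Icc _ _ from ⟨by
      rw [hφf _ (hgm hz.1)]
      exact (hηg hz.2).le, by
      by_contra! hcon
      exact hδK (mem_ball.2 (hcon.trans hr.2)) ⟨c, hc, rfl⟩⟩)
    exact ⟨y, hy, φ y, ⟨hφm (hs hy), hyr⟩, hfφ y (hs hy)⟩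
  have hproj : ∀ n : ℂ, ‖n‖ = 1 → ∀ z ∈ W, ∀ z' ∈ W, |inner ℝ n (f (g z))| ≤ 1 / 2 →
      |inner ℝ n (f (g z)) - inner ℝ n (f (g z'))| ≤ e := by
    intro n hn z hz z' hz' hle
    set S : Set ℝ := (innerSL ℝ n) '' ((fun z => f (g z)) '' W) ∩ Icc (-(3 / 4)) (3 / 4) with hS
    have hSC : S ⊆ (innerSL ℝ n) '' (f '' (Ω ∩ sphere (g p) r)) := by
      rintro s ⟨⟨_, ⟨x, hx, rfl⟩, hxs⟩, hs⟩
      have hc : (s : ℝ) • n ∈ closedBall (0 : ℂ) (3 / 4) := by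
        rw [mem_closedBall_zero_iff, norm_smul, hn, mul_one, Real.norm_eq_abs]
        exact abs_le.2 hs
      obtain ⟨y, hy, hyC⟩ := hseg x hx _ hc
      refine ⟨y, hyC, ?_⟩
      obtain ⟨a, b, ha, hb, hab, rfl⟩ := hy
      simp only [innerSL_apply_apply] at hxs ⊢
      rw [inner_add_right, real_inner_smul_right, real_inner_smul_right, real_inner_smul_right,
        hxs, real_inner_self_eq_norm_sq, hn]
      linear_combination s * hab
    have hSv : volume S ≤ ENNReal.ofReal e :=
      (measure_mono hSC).trans (hrℓ (innerSL ℝ n) (by rw [innerSL_apply_norm, hn]))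
    have hSo : OrdConnected S :=
      ((hWc.image _ (innerSL ℝ n).continuous.continuousOn).ordConnected).inter ordConnected_Icc
    have hSp : IsPreconnected S := hSo.isPreconnected
    have hI : OrdConnected ((innerSL ℝ n) '' ((fun z => f (g z)) '' W)) :=
      (hWc.image _ (innerSL ℝ n).continuous.continuousOn).ordConnected
    have hmem : ∀ x ∈ W, inner ℝ n (f (g x)) ∈ (innerSL ℝ n) '' ((fun z => f (g z)) '' W) :=
      fun x hx => ⟨_, ⟨x, hx, rfl⟩, rfl⟩
    set s := inner ℝ n (f (g z))
    set s' := inner ℝ n (f (g z'))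
    have hsS : s ∈ S := ⟨hmem z hz, by rw [abs_le] at hle; constructor <;> linarith⟩
    rw [abs_le] at hle
    by_contra! hcon
    rcases lt_abs.1 hcon with h | h
    · have h1 : max s' (-(3 / 4)) ∈ S := by
        refine ⟨hI.out (hmem z' hz') (hmem z hz) ⟨le_max_left _ _, max_le (by linarith)
          (by linarith)⟩, le_max_right _ _, max_le (by linarith) (by norm_num)⟩
      have h2 := abs_le.1 (hSp.abs_sub_le_of_volume_le he0.le hsS h1 hSv)
      rcases max_choice s' (-(3 / 4)) with h3 | h3 <;> rw [h3] at h2 <;> linarith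
    · have h1 : min s' (3 / 4) ∈ S := by
        refine ⟨hI.out (hmem z hz) (hmem z' hz') ⟨le_min (by linarith) (by linarith),
          min_le_left _ _⟩, le_min (by linarith) (by norm_num), min_le_right _ _⟩
      have h2 := abs_le.1 (hSp.abs_sub_le_of_volume_le he0.le hsS h1 hSv)
      rcases min_choice s' (3 / 4) with h3 | h3 <;> rw [h3] at h2 <;> linarith
  refine ⟨η, hη, fun z hz z' hz' => ?_⟩
  set x := f (g z) with hx
  set x' := f (g z') with hx'
  have hx1 : ‖x‖ < 1 := mem_ball_zero_iff.1 (hfm (hgm hz.1))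
  obtain ⟨u, hu, hxu⟩ : ∃ u : ℂ, ‖u‖ = 1 ∧ x = ‖x‖ * u := by
    by_cases h : x = 0
    · exact ⟨1, norm_one, by simp [h]⟩
    · refine ⟨x / ‖x‖, ?_, ?_⟩
      · rw [norm_div, Complex.norm_real, norm_norm, div_self (norm_ne_zero_iff.2 h)]
      · have : (‖x‖ : ℂ) ≠ 0 := by exact_mod_cast norm_ne_zero_iff.2 h
        field_simp
  have huu : u.re * u.re + u.im * u.im = 1 := by
    have := Complex.sq_norm u
    rw [hu, Complex.normSq_apply] at this
    linarith
  have hin : ∀ w : ℂ, inner ℝ u w = u.re * w.re + u.im * w.im := by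
    intro w; rw [Complex.inner]; simp; ring
  have hin2 : ∀ w : ℂ, inner ℝ (Complex.I * u) w = u.re * w.im - u.im * w.re := by
    intro w; rw [Complex.inner]; simp; ring
  have h3 : √3 ^ 2 = 3 := Real.sq_sqrt (by norm_num)
  set n : ℂ := ((1 / 2 : ℝ) : ℂ) * u + ((√3 / 2 : ℝ) : ℂ) * (Complex.I * u) with hn
  have hn1 : ‖n‖ = 1 := by
    rw [hn, show ((1 / 2 : ℝ) : ℂ) * u + ((√3 / 2 : ℝ) : ℂ) * (Complex.I * u) =
      (((1 / 2 : ℝ) : ℂ) + ((√3 / 2 : ℝ) : ℂ) * Complex.I) * u by ring, norm_mul, hu, mul_one]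
    refine (pow_left_inj₀ (norm_nonneg _) zero_le_one two_ne_zero).1 ?_
    rw [Complex.sq_norm, Complex.normSq_add_mul_I]
    nlinarith
  have hin3 : ∀ w : ℂ, inner ℝ n w = 1 / 2 * inner ℝ u w + √3 / 2 * inner ℝ (Complex.I * u) w := by
    intro w
    rw [hn, ← Complex.real_smul, ← Complex.real_smul, inner_add_left, real_inner_smul_left,
      real_inner_smul_left]
  have hIx : inner ℝ (Complex.I * u) x = 0 := by
    rw [hin2, hxu]
    simp
    ring
  have hux : inner ℝ u x = ‖x‖ := by
    rw [hin]
    conv_lhs => rw [hxu]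
    simp only [Complex.re_ofReal_mul, Complex.im_ofReal_mul]
    linear_combination ‖x‖ * huu
  have p1 := hproj (Complex.I * u) (by rw [norm_mul, Complex.norm_I, hu, one_mul]) z hz z' hz'
    (by rw [← hx, hIx, abs_zero]; norm_num)
  have p2 := hproj n hn1 z hz z' hz' (by
    rw [← hx, hin3, hIx, hux, mul_zero, add_zero, abs_of_nonneg (by positivity)]; linarith)
  rw [← hx, ← hx'] at p1 p2
  rw [hin3 x, hin3 x'] at p2
  set A := inner ℝ u x - inner ℝ u x' with hA
  set B := inner ℝ (Complex.I * u) x - inner ℝ (Complex.I * u) x' with hB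
  have hs3 : √3 ≤ 2 := by
    rw [Real.sqrt_le_left (by norm_num)]; norm_num
  have hs30 : 0 ≤ √3 := Real.sqrt_nonneg 3
  have p3 : |1 / 2 * A + √3 / 2 * B| ≤ e := by
    convert p2 using 2
    rw [hA, hB]; ring
  have p4 : |√3 / 2 * B| ≤ e := by
    rw [abs_mul, abs_of_nonneg (by positivity)]
    nlinarith [abs_nonneg B]
  have p5 : |A| ≤ 4 * e := by
    rw [abs_le] at p3 p4 ⊢
    constructor <;> linarith
  have p6 : ‖x - x'‖ ≤ |A| + |B| := by
    have e1 : ‖x - x'‖ = ‖(starRingEnd ℂ) u * (x - x')‖ := by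
      rw [norm_mul, RCLike.norm_conj, hu, one_mul]
    rw [e1]
    refine (Complex.norm_le_abs_re_add_abs_im _).trans (le_of_eq ?_)
    congr 2
    · rw [hA, hin, hin]; simp; ring
    · rw [hB, hin2, hin2]; simp; ring
  rw [dist_eq_norm]
  linarith

theorem IsDiscEmbedding.exists_inverse {U : Set ℂ} (hU : IsOpen U) {z₀ : ℂ} (hz₀ : z₀ ∈ U)
    {f : ℂ → ℂ} (hf : IsDiscEmbedding U z₀ f) (hs : SurjOn f U (ball 0 1)) :
    ∃ φ : ℂ → ℂ, DifferentiableOn ℂ φ (ball 0 1) ∧ MapsTo φ (ball 0 1) U ∧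
      (∀ w ∈ ball (0 : ℂ) 1, f (φ w) = w) ∧ (∀ z ∈ U, φ (f z) = z) ∧ φ 0 = z₀ ∧
      deriv φ 0 ≠ 0 := by
  set φ := invFunOn f U with hφ
  have hm : MapsTo φ (ball 0 1) U := fun w hw => invFunOn_mem (hs hw)
  have hr : ∀ w ∈ ball (0 : ℂ) 1, f (φ w) = w := fun w hw => invFunOn_eq (hs hw)
  have hl : ∀ z ∈ U, φ (f z) = z := fun z hz => hf.inj.leftInvOn_invFunOn hz
  have hd : ∀ w ∈ ball (0 : ℂ) 1, HasDerivAt φ (deriv f (φ w))⁻¹ w := by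
    intro w hw
    have hU' := hU.mem_nhds (hm hw)
    have hne := hf.deriv_ne_zero _ (hm hw)
    have hst := (hf.diff.analyticAt hU').hasStrictDerivAt
    have hmap := hst.map_nhds_eq hne
    rw [hr w hw] at hmap
    refine HasDerivAt.of_local_left_inverse ?_ hst.hasDerivAt hne ?_
    · intro V hV
      rw [← hmap, Filter.map_map, Filter.mem_map]
      filter_upwards [hV, hU'] with z hz hzU
      rw [mem_preimage, comp_apply, hl z hzU]
      exact hz
    · filter_upwards [isOpen_ball.mem_nhds hw] with y hy using hr y hy
  have h0 : φ 0 = z₀ := by rw [← hf.map_base, hl z₀ hz₀]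
  refine ⟨φ, fun w hw => (hd w hw).differentiableAt.differentiableWithinAt, hm, hr, hl, h0, ?_⟩
  rw [(hd 0 (mem_ball_self one_pos)).deriv]
  exact inv_ne_zero (hf.deriv_ne_zero _ (hm (mem_ball_self one_pos)))

/-- A self-map of the disc with vanishing boundary oscillation extends to the closed disc. -/
theorem exists_continuousOn_closedBall_extension {h : ℂ → ℂ} (hc : ContinuousOn h (ball 0 1))
    (hm : MapsTo h (ball 0 1) (ball 0 1))
    (hosc : ∀ ζ : ℂ, ‖ζ‖ = 1 → ∀ ε > 0, ∃ r > 0, ∀ w ∈ ball (0 : ℂ) 1 ∩ ball ζ r,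
      ∀ w' ∈ ball (0 : ℂ) 1 ∩ ball ζ r, dist (h w) (h w') ≤ ε) :
    ∃ H : ℂ → ℂ, ContinuousOn H (closedBall 0 1) ∧ EqOn H h (ball 0 1) ∧
      MapsTo H (closedBall 0 1) (closedBall 0 1) := by
  have hcl : closedBall (0 : ℂ) 1 ⊆ closure (ball 0 1) := (closure_ball 0 one_ne_zero).ge
  have hlim : ∀ x ∈ closedBall (0 : ℂ) 1, ∃ y, Tendsto h (𝓝[ball 0 1] x) (𝓝 y) := by
    intro x hx
    rcases (mem_closedBall_zero_iff.1 hx).lt_or_eq with hx1 | hx1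
    · exact ⟨h x, hc x (mem_ball_zero_iff.2 hx1)⟩
    · have : (𝓝[ball 0 1] x).NeBot := mem_closure_iff_nhdsWithin_neBot.1 (hcl hx)
      rw [← cauchy_map_iff_exists_tendsto, Metric.cauchy_iff]
      refine ⟨inferInstance, fun ε hε => ?_⟩
      obtain ⟨r, hr, h1⟩ := hosc x hx1 (ε / 2) (by positivity)
      refine ⟨h '' (ball 0 1 ∩ ball x r), image_mem_map (inter_mem self_mem_nhdsWithin
        (mem_nhdsWithin_of_mem_nhds (ball_mem_nhds x hr))), ?_⟩
      rintro _ ⟨a, ha, rfl⟩ _ ⟨b, hb, rfl⟩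
      linarith [h1 a ha b hb]
  have hEq : EqOn (extendFrom (ball 0 1) h) h (ball 0 1) := fun x hx =>
    extendFrom_eq (subset_closure hx) (hc x hx)
  have hC := continuousOn_extendFrom hcl hlim
  refine ⟨extendFrom (ball 0 1) h, hC, hEq, ?_⟩
  have h1 : MapsTo (extendFrom (ball 0 1) h) (ball 0 1) (ball 0 1) := fun x hx => by
    rw [hEq hx]; exact hm hx
  have h2 := h1.closure_of_continuousOn (by rwa [closure_ball _ one_ne_zero])
  rwa [closure_ball _ one_ne_zero] at h2

/-- The image of the unit disc under a homeomorphism of the plane is uniformised by a conformal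
map whose composition with the homeomorphism extends to the closed disc. -/
theorem exists_conformal_factorisation (g : ℂ ≃ₜ ℂ) :
    ∃ φ Ψ Θ : ℂ → ℂ, DifferentiableOn ℂ φ (ball 0 1) ∧ φ 0 = g 0 ∧ deriv φ 0 ≠ 0 ∧
      ContinuousOn Ψ (closedBall 0 1) ∧ ContinuousOn Θ (closedBall 0 1) ∧
      MapsTo Ψ (ball 0 1) (ball 0 1) ∧ MapsTo Θ (ball 0 1) (ball 0 1) ∧
      MapsTo Ψ (sphere 0 1) (sphere 0 1) ∧ MapsTo Θ (sphere 0 1) (sphere 0 1) ∧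
      (∀ z ∈ closedBall (0 : ℂ) 1, Θ (Ψ z) = z) ∧ (∀ w ∈ closedBall (0 : ℂ) 1, Ψ (Θ w) = w) ∧
      (∀ z ∈ ball (0 : ℂ) 1, φ (Ψ z) = g z) ∧ Ψ 0 = 0 ∧ Ψ 1 = 1 := by
  set Ω : Set ℂ := g '' ball 0 1 with hΩdef
  have hΩ : IsOpen Ω := g.isOpenMap _ isOpen_ball
  have h0 : (0 : ℂ) ∈ ball (0 : ℂ) 1 := mem_ball_self one_pos
  have hg0 : g 0 ∈ Ω := mem_image_of_mem g h0
  have hb : Bornology.IsBounded Ω :=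
    ((isCompact_closedBall (0 : ℂ) 1).image g.continuous).isBounded.subset
      (image_mono ball_subset_closedBall)
  have hsc : IsSimplyConnected Ω := by
    rw [hΩdef, g.isSimplyConnected_image]
    have : ContractibleSpace (ball (0 : ℂ) 1) :=
      (convex_ball (0 : ℂ) 1).contractibleSpace ⟨0, h0⟩
    exact SimplyConnectedSpace.ofContractible _
  obtain ⟨f, hf, hfs⟩ := exists_isDiscEmbedding_surjOn hΩ hsc hb hg0
  obtain ⟨φ, hφd, hφm, hfφ, hφf, hφ0, hφ'⟩ := hf.exists_inverse hΩ hg0 hfs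
  have hgm : MapsTo g (ball 0 1) Ω := mapsTo_image _ _
  have hgsm : ∀ w ∈ Ω, g.symm w ∈ ball (0 : ℂ) 1 := by
    rintro _ ⟨z, hz, rfl⟩
    rwa [g.symm_apply_apply]
  have hψc : ContinuousOn (fun z => f (g z)) (ball 0 1) :=
    hf.diff.continuousOn.comp g.continuous.continuousOn hgm
  have hψm : MapsTo (fun z => f (g z)) (ball 0 1) (ball 0 1) := hf.mapsTo.comp hgm
  have hθc : ContinuousOn (fun w => g.symm (φ w)) (ball 0 1) :=
    g.symm.continuous.comp_continuousOn hφd.continuousOn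
  have hθm : MapsTo (fun w => g.symm (φ w)) (ball 0 1) (ball 0 1) := fun w hw => hgsm _ (hφm hw)
  have hψθ : ∀ w ∈ ball (0 : ℂ) 1, f (g (g.symm (φ w))) = w := fun w hw => by
    rw [g.apply_symm_apply, hfφ w hw]
  have hθψ : ∀ z ∈ ball (0 : ℂ) 1, g.symm (φ (f (g z))) = z := fun z hz => by
    rw [hφf _ (hgm hz), g.symm_apply_apply]
  have hφi : InjOn φ (ball 0 1) := fun x hx y hy h => by rw [← hfφ x hx, h, hfφ y hy]
  obtain ⟨Θ, hΘc, hΘe, hΘm⟩ := exists_continuousOn_closedBall_extension hθc hθm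
    fun ζ hζ ε hε => exists_ball_dist_le_of_conformal hφd hφi
      (hb.subset (image_subset_iff.2 hφm)) g.symm.continuous hθm hψc hψm hψθ hθψ hf.map_base hζ hε
  obtain ⟨Ψ, hΨc, hΨe, hΨm⟩ := exists_continuousOn_closedBall_extension hψc hψm
    fun p hp ε hε => exists_ball_dist_le_of_conformal_symm hΩ hf.diff hf.inj hf.mapsTo
      hφd.continuousOn hφm hfφ hφf g.continuous hgm (p := p) (by
        rintro ⟨z, hz, hzp⟩
        rw [g.injective hzp, mem_ball_zero_iff, hp] at hz
        exact lt_irrefl _ hz) hε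
  have hcl : closedBall (0 : ℂ) 1 ⊆ closure (ball 0 1) := (closure_ball 0 one_ne_zero).ge
  have hΨb : MapsTo Ψ (ball 0 1) (ball 0 1) := fun z hz => by rw [hΨe hz]; exact hψm hz
  have hΘb : MapsTo Θ (ball 0 1) (ball 0 1) := fun z hz => by rw [hΘe hz]; exact hθm hz
  have hΘΨ : EqOn (fun z => Θ (Ψ z)) id (closedBall 0 1) := by
    refine EqOn.of_subset_closure (s := ball 0 1) (fun z hz => ?_) (hΘc.comp hΨc hΨm)
      continuousOn_id ball_subset_closedBall hcl
    simp only [id]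
    rw [hΘe (hΨb hz), hΨe hz]
    exact hθψ z hz
  have hΨΘ : EqOn (fun z => Ψ (Θ z)) id (closedBall 0 1) := by
    refine EqOn.of_subset_closure (s := ball 0 1) (fun z hz => ?_) (hΨc.comp hΘc hΘm)
      continuousOn_id ball_subset_closedBall hcl
    simp only [id]
    rw [hΨe (hΘb hz), hΘe hz]
    exact hψθ z hz
  have hsph : ∀ A B : ℂ → ℂ, MapsTo A (closedBall 0 1) (closedBall 0 1) →
      MapsTo B (ball 0 1) (ball 0 1) → EqOn (fun z => B (A z)) id (closedBall 0 1) →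
      MapsTo A (sphere 0 1) (sphere 0 1) := by
    intro A B hA hB hBA z hz
    have h1 := hA (sphere_subset_closedBall hz)
    rw [mem_sphere_zero_iff_norm] at hz ⊢
    rcases (mem_closedBall_zero_iff.1 h1).lt_or_eq with h2 | h2
    · have h3 := hB (mem_ball_zero_iff.2 h2)
      have h4 : B (A z) = z := hBA (mem_closedBall_zero_iff.2 hz.le)
      rw [h4, mem_ball_zero_iff, hz] at h3
      exact absurd h3 (lt_irrefl _)
    · exact h2
  have hΨs := hsph Ψ Θ hΨm hΘb hΘΨ
  have hΘs := hsph Θ Ψ hΘm hΨb hΨΘ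
  have hc1 : ‖Ψ 1‖ = 1 := mem_sphere_zero_iff_norm.1 (hΨs (by simp))
  set c : ℂ := Ψ 1 with hc
  have hcc : (starRingEnd ℂ) c * c = 1 := by
    rw [mul_comm, Complex.mul_conj, Complex.normSq_eq_norm_sq, hc1]; norm_num
  have hcc' : c * (starRingEnd ℂ) c = 1 := by rw [mul_comm, hcc]
  have hccn : ‖(starRingEnd ℂ) c‖ = 1 := by rw [RCLike.norm_conj, hc1]
  have hrot : ∀ (d : ℂ), ‖d‖ = 1 → ∀ r : ℝ, MapsTo (fun w => d * w) (ball (0 : ℂ) r) (ball 0 r) ∧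
      MapsTo (fun w => d * w) (sphere (0 : ℂ) r) (sphere 0 r) ∧
      MapsTo (fun w => d * w) (closedBall (0 : ℂ) r) (closedBall 0 r) := by
    intro d hd r
    refine ⟨fun w hw => ?_, fun w hw => ?_, fun w hw => ?_⟩
    · rw [mem_ball_zero_iff] at *; rwa [norm_mul, hd, one_mul]
    · rw [mem_sphere_zero_iff_norm] at *; rwa [norm_mul, hd, one_mul]
    · rw [mem_closedBall_zero_iff] at *; rwa [norm_mul, hd, one_mul]
  refine ⟨fun w => φ (c * w), fun z => (starRingEnd ℂ) c * Ψ z, fun w => Θ (c * w), ?_, ?_, ?_, ?_,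
    ?_, (hrot _ hccn 1).1.comp hΨb, hΘb.comp (hrot _ hc1 1).1, (hrot _ hccn 1).2.1.comp hΨs,
    hΘs.comp (hrot _ hc1 1).2.1, ?_, ?_, ?_, ?_, ?_⟩
  · exact hφd.comp (by fun_prop) (hrot _ hc1 1).1
  · simp only [mul_zero, hφ0]
  · have h1 : HasDerivAt φ (deriv φ 0) (c * 0) := by
      rw [mul_zero]
      exact (hφd.differentiableAt (isOpen_ball.mem_nhds h0)).hasDerivAt
    have h2 := h1.comp (0 : ℂ) ((hasDerivAt_id (0 : ℂ)).const_mul c)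
    have h3 : deriv (fun w => φ (c * w)) 0 = deriv φ 0 * (c * 1) := h2.deriv
    rw [h3, mul_one]
    refine mul_ne_zero hφ' ?_
    rintro h4
    rw [h4, norm_zero] at hc1
    exact zero_ne_one hc1
  · exact continuousOn_const.mul hΨc
  · exact hΘc.comp (by fun_prop) (hrot _ hc1 1).2.2
  · intro z hz
    simp only [← mul_assoc, hcc', one_mul]
    exact hΘΨ hz
  · intro w hw
    have := hΨΘ ((hrot _ hc1 1).2.2 hw)
    simp only [id] at this
    simp only [this, ← mul_assoc, hcc, one_mul]
  · intro z hz
    simp only [← mul_assoc, hcc', one_mul]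
    rw [hΨe hz, hφf _ (hgm hz)]
  · simp only [hΨe h0, hf.map_base, mul_zero]
  · exact hcc

/-- A homeomorphism of the plane interpolating between `σ` on the real axis and `x ↦ s * x` far
below it. -/
theorem exists_homeomorph_interpolation {σ : ℝ → ℝ} {s : ℝ} (hs : s * s = 1) (hσ : Continuous σ)
    (hmono : StrictMono fun x => s * σ x) (hsurj : Surjective fun x => s * σ x) :
    ∃ F : ℂ ≃ₜ ℂ, (∀ w, (F w).im = w.im) ∧ (∀ w, 0 ≤ w.im → (F w).re = σ w.re) ∧
      (∀ w, w.im ≤ -1 → (F w).re = s * w.re) := by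
  set t : ℝ → ℝ := fun y => min (max (-y) 0) 1 with ht
  have ht0 : ∀ y, 0 ≤ t y := fun y => le_min (le_max_right _ _) zero_le_one
  have ht1 : ∀ y, t y ≤ 1 := fun y => min_le_right _ _
  set l : ℝ → ℝ → ℝ := fun y x => (1 - t y) * σ x + t y * (s * x) with hl
  set F : ℂ → ℂ := fun w => ((l w.im w.re : ℝ) : ℂ) + (w.im : ℂ) * Complex.I with hF
  have hFre : ∀ w, (F w).re = l w.im w.re := fun w => by simp [hF]
  have hFim : ∀ w, (F w).im = w.im := fun w => by simp [hF]
  have hsl : ∀ y x, s * l y x = (1 - t y) * (s * σ x) + t y * x := fun y x => by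
    simp only [hl]; linear_combination t y * x * hs
  have hs0 : s ≠ 0 := by rintro rfl; simp at hs
  have habs : ∀ x, |s * x| = |x| := fun x => by
    have : |s| = 1 := by
      have h1 : |s| * |s| = 1 := by rw [← abs_mul, hs, abs_one]
      nlinarith [abs_nonneg s]
    rw [abs_mul, this, one_mul]
  have hlmono : ∀ y, StrictMono fun x => s * l y x := by
    intro y a b hab
    simp only [hsl]
    have h1 : s * σ a < s * σ b := hmono hab
    rcases (ht0 y).eq_or_lt with h | h
    · rw [← h]; linarith
    · have := mul_le_mul_of_nonneg_left h1.le (sub_nonneg.2 (ht1 y))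
      have := mul_lt_mul_of_pos_left hab h
      linarith
  have hupper : ∀ v, ∃ b, v ≤ b ∧ ∀ y x, b ≤ x → v ≤ s * l y x := by
    intro v
    obtain ⟨x₁, hx₁⟩ := hsurj v
    refine ⟨max x₁ v, le_max_right _ _, fun y x hx => ?_⟩
    rw [hsl]
    have h1 : v ≤ s * σ x := by
      rw [← hx₁]; exact hmono.monotone ((le_max_left _ _).trans hx)
    have h2 : v ≤ x := (le_max_right _ _).trans hx
    nlinarith [mul_le_mul_of_nonneg_left h1 (sub_nonneg.2 (ht1 y)),
      mul_le_mul_of_nonneg_left h2 (ht0 y)]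
  have hlower : ∀ v, ∃ a, a ≤ v ∧ ∀ y x, x ≤ a → s * l y x ≤ v := by
    intro v
    obtain ⟨x₁, hx₁⟩ := hsurj v
    refine ⟨min x₁ v, min_le_right _ _, fun y x hx => ?_⟩
    rw [hsl]
    have h1 : s * σ x ≤ v := by
      rw [← hx₁]; exact hmono.monotone (hx.trans (min_le_left _ _))
    have h2 : x ≤ v := hx.trans (min_le_right _ _)
    nlinarith [mul_le_mul_of_nonneg_left h1 (sub_nonneg.2 (ht1 y)),
      mul_le_mul_of_nonneg_left h2 (ht0 y)]
  have hFc : Continuous F := by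
    have : Continuous fun w : ℂ => l w.im w.re := by
      simp only [hl, ht]
      fun_prop
    fun_prop
  have hinj : Injective F := by
    intro w w' h
    have h1 : w.im = w'.im := by rw [← hFim w, h, hFim]
    have h2 : l w.im w.re = l w'.im w'.re := by rw [← hFre w, h, hFre]
    rw [← h1] at h2
    exact Complex.ext ((hlmono w.im).injective (congrArg (s * ·) h2)) h1
  have hsurjF : Surjective F := by
    intro w
    obtain ⟨b, hb, hb'⟩ := hupper (s * w.re)
    obtain ⟨a, ha, ha'⟩ := hlower (s * w.re)
    have hcont : Continuous fun x => s * l w.im x := by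
      simp only [hl]
      fun_prop
    obtain ⟨x, -, hx⟩ := intermediate_value_Icc (ha.trans hb) hcont.continuousOn
      ⟨ha' w.im a le_rfl, hb' w.im b le_rfl⟩
    have hx' : l w.im x = w.re := mul_left_cancel₀ hs0 hx
    exact ⟨⟨x, w.im⟩, Complex.ext (by rw [hFre]; exact hx') (by rw [hFim])⟩
  have hprop : IsProperMap F := by
    rw [isProperMap_iff_isCompact_preimage]
    refine ⟨hFc, fun K hK => ?_⟩
    refine Metric.isCompact_of_isClosed_isBounded (hK.isClosed.preimage hFc) ?_
    obtain ⟨R, hR⟩ := hK.isBounded.subset_closedBall 0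
    obtain ⟨b, -, hb⟩ := hupper (R + 1)
    obtain ⟨a, -, ha⟩ := hlower (-(R + 1))
    refine isBounded_closedBall.subset (s := F ⁻¹' K) (t := closedBall 0 (max |a| |b| + R)) ?_
    intro w hw
    have h1 : ‖F w‖ ≤ R := mem_closedBall_zero_iff.1 (hR hw)
    have h2 : |w.im| ≤ R := by rw [← hFim]; exact (Complex.abs_im_le_norm _).trans h1
    have h3 : |s * l w.im w.re| ≤ R := by
      rw [habs, ← hFre]; exact (Complex.abs_re_le_norm _).trans h1
    rw [abs_le] at h3
    have h4 : w.re ≤ b := by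
      by_contra! h
      linarith [hb w.im w.re h.le]
    have h5 : a ≤ w.re := by
      by_contra! h
      linarith [ha w.im w.re h.le]
    rw [mem_closedBall_zero_iff]
    have h6 := Complex.norm_le_abs_re_add_abs_im w
    have h7 : |w.re| ≤ max |a| |b| := abs_le_max_abs_abs h5 h4
    linarith
  refine ⟨IsHomeomorph.homeomorph F (isHomeomorph_iff_continuous_isClosedMap_bijective.2
    ⟨hFc, hprop.isClosedMap, hinj, hsurjF⟩), hFim, fun w hw => ?_, fun w hw => ?_⟩
  · refine (hFre w).trans ?_
    have : t w.im = 0 := by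
      simp only [ht]
      rw [max_eq_right (by linarith), min_eq_left zero_le_one]
    simp only [hl, this]
    ring
  · refine (hFre w).trans ?_
    have : t w.im = 1 := by
      simp only [ht]
      rw [max_eq_left (by linarith), min_eq_right (by linarith)]
    simp only [hl, this]
    ring

/-- A self-homeomorphism of the closed upper half-plane extends to the plane so as to be the
identity or the reflection far below the real axis. -/
theorem exists_homeomorph_extending_halfPlane {K K' : ℂ → ℂ}
    (hK : ContinuousOn K {w | 0 ≤ w.im}) (hK' : ContinuousOn K' {w | 0 ≤ w.im})
    (hKm : ∀ w : ℂ, 0 ≤ w.im → 0 ≤ (K w).im) (hKm' : ∀ w : ℂ, 0 ≤ w.im → 0 ≤ (K' w).im)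
    (hK0 : ∀ w : ℂ, w.im = 0 → (K w).im = 0) (hK0' : ∀ w : ℂ, w.im = 0 → (K' w).im = 0)
    (hl : ∀ w : ℂ, 0 ≤ w.im → K' (K w) = w) (hr : ∀ w : ℂ, 0 ≤ w.im → K (K' w) = w) :
    ∃ H : ℂ ≃ₜ ℂ, (∀ w : ℂ, 0 ≤ w.im → H w = K w) ∧
      ((∀ w : ℂ, w.im ≤ -1 → H w = w) ∨
        (∀ w : ℂ, w.im ≤ -1 → H w = -(starRingEnd ℂ) w)) := by
  set σ : ℝ → ℝ := fun x => (K x).re with hσ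
  set σ' : ℝ → ℝ := fun x => (K' x).re with hσ'
  have hKx : ∀ x : ℝ, K x = σ x := fun x => Complex.ext rfl (by
    rw [Complex.ofReal_im]; exact hK0 _ (Complex.ofReal_im x))
  have hKx' : ∀ x : ℝ, K' x = σ' x := fun x => Complex.ext rfl (by
    rw [Complex.ofReal_im]; exact hK0' _ (Complex.ofReal_im x))
  have hσc : Continuous σ := by
    refine Complex.continuous_re.comp ?_
    rw [← continuousOn_univ]
    exact hK.comp Complex.continuous_ofReal.continuousOn fun x _ => (Complex.ofReal_im x).ge
  have hll : ∀ x, σ' (σ x) = x := fun x => by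
    have := hl x (Complex.ofReal_im x).ge
    rw [hKx, hKx'] at this
    exact_mod_cast this
  have hrr : ∀ x, σ (σ' x) = x := fun x => by
    have := hr x (Complex.ofReal_im x).ge
    rw [hKx', hKx] at this
    exact_mod_cast this
  obtain ⟨s, hs, hmono⟩ : ∃ s : ℝ, (s = 1 ∨ s = -1) ∧ StrictMono fun x => s * σ x := by
    rcases hσc.strictMono_of_inj (LeftInverse.injective hll) with h | h
    · exact ⟨1, .inl rfl, by simpa using h⟩
    · refine ⟨-1, .inr rfl, fun a b hab => ?_⟩
      have := h hab
      simp only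
      linarith
  have hss : s * s = 1 := by rcases hs with rfl | rfl <;> norm_num
  obtain ⟨F, hFim, hF0, hF1⟩ := exists_homeomorph_interpolation hss hσc hmono fun v =>
    ⟨σ' (s * v), by simp only [hrr]; linear_combination v * hss⟩
  have hKF : ∀ w : ℂ, w.im = 0 → K w = F w := fun w hw => by
    refine Complex.ext ?_ (by rw [hK0 w hw, hFim, hw])
    rw [hF0 w hw.ge]
    simp only [hσ]
    congr 2
    exact Complex.ext (by simp) (by simp [hw])
  have hFKs : ∀ w : ℂ, w.im = 0 → K' w = F.symm w := fun w hw => by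
    rw [F.eq_symm_apply, ← hKF _ (hK0' w hw), hr w hw.ge]
  have hFsim : ∀ w, (F.symm w).im = w.im := fun w => by
    rw [← hFim, F.apply_symm_apply]
  refine ⟨⟨⟨fun w => if 0 ≤ w.im then K w else F w, fun w => if 0 ≤ w.im then K' w else F.symm w,
    fun w => ?_, fun w => ?_⟩, ?_, ?_⟩, fun w hw => if_pos hw, ?_⟩
  · simp only
    by_cases h : 0 ≤ w.im
    · rw [if_pos h, if_pos (hKm w h), hl w h]
    · rw [if_neg h, hFim, if_neg h, F.symm_apply_apply]
  · simp only
    by_cases h : 0 ≤ w.im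
    · rw [if_pos h, if_pos (hKm' w h), hr w h]
    · rw [if_neg h, hFsim, if_neg h, F.apply_symm_apply]
  · exact continuous_if_le continuous_const Complex.continuous_im hK F.continuous.continuousOn
      fun w hw => hKF w hw.symm
  · exact continuous_if_le continuous_const Complex.continuous_im hK' F.symm.continuous.continuousOn
      fun w hw => hFKs w hw.symm
  · have hlow : ∀ w : ℂ, w.im ≤ -1 → ¬ 0 ≤ w.im := fun w hw => by linarith
    rcases hs with rfl | rfl
    · left
      intro w hw
      refine (if_neg (hlow w hw)).trans (Complex.ext ?_ (hFim w))
      rw [hF1 w hw, one_mul]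
    · right
      intro w hw
      refine (if_neg (hlow w hw)).trans (Complex.ext ?_ ?_)
      · rw [hF1 w hw]; simp
      · rw [hFim]; simp

/-- Near the origin, a homeomorphism of the plane is a conformal map composed with a homeomorphism
of the plane that is the identity or a reflection on some nonempty open set, composed with another
conformal map. -/
theorem exists_local_factorisation (g : ℂ ≃ₜ ℂ) :
    ∃ (μ ν : ℂ → ℂ) (H : ℂ ≃ₜ ℂ), AnalyticAt ℂ μ 0 ∧ deriv μ 0 ≠ 0 ∧ H (μ 0) = μ 0 ∧
      AnalyticAt ℂ ν (μ 0) ∧ deriv ν (μ 0) ≠ 0 ∧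
      (∀ᶠ z in 𝓝 0, g z = ν (H (μ z))) ∧
      ((∀ w : ℂ, w.im ≤ -1 → H w = w) ∨
        (∀ w : ℂ, w.im ≤ -1 → H w = -(starRingEnd ℂ) w)) := by
  obtain ⟨φ, Ψ, Θ, hφ, hφ0, hφ', hΨ, hΘ, hΨb, hΘb, hΨs, hΘs, hΘΨ, hΨΘ, hg, hΨ0, hΨ1⟩ :=
    exists_conformal_factorisation g
  set m : ℂ → ℂ := fun z => Complex.I * (1 + z) / (1 - z) with hm
  set m' : ℂ → ℂ := fun w => (w - Complex.I) / (w + Complex.I) with hm'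
  have hden : ∀ w : ℂ, 0 ≤ w.im → w + Complex.I ≠ 0 := by
    intro w hw h
    have := congrArg Complex.im h
    simp at this
    linarith
  have hm'1 : ∀ w : ℂ, 0 ≤ w.im → m' w ≠ 1 := by
    intro w hw h
    simp only [hm'] at h
    rw [div_eq_one_iff_eq (hden w hw)] at h
    have : (2 : ℂ) * Complex.I = 0 := by linear_combination -h
    simp at this
  have hmm' : ∀ w : ℂ, 0 ≤ w.im → m (m' w) = w := by
    intro w hw
    have h1 := hden w hw
    have h2 : 1 - (w - Complex.I) / (w + Complex.I) = 2 * Complex.I / (w + Complex.I) := by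
      field_simp; ring
    simp only [hm, hm']
    rw [h2]
    have := Complex.I_ne_zero
    field_simp
    ring
  have hm'm : ∀ z : ℂ, z ≠ 1 → m' (m z) = z := by
    intro z hz
    have h1 : 1 - z ≠ 0 := sub_ne_zero.2 hz.symm
    simp only [hm, hm']
    have h2 : Complex.I * (1 + z) / (1 - z) + Complex.I = 2 * Complex.I / (1 - z) := by
      field_simp; ring
    rw [h2]
    have := Complex.I_ne_zero
    field_simp
    ring
  have hnsq : ∀ w : ℂ, 0 ≤ w.im → 1 - ‖m' w‖ ^ 2 = 4 * w.im / ‖w + Complex.I‖ ^ 2 := by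
    intro w hw
    have h1 : ‖w + Complex.I‖ ≠ 0 := norm_ne_zero_iff.2 (hden w hw)
    simp only [hm']
    rw [norm_div, div_pow, eq_div_iff (by positivity), sub_mul, div_mul_cancel₀ _ (by positivity),
      Complex.sq_norm, Complex.sq_norm, Complex.normSq_apply, Complex.normSq_apply]
    simp
    ring
  have hmem : ∀ w : ℂ, 0 ≤ w.im → m' w ∈ closedBall (0 : ℂ) 1 := by
    intro w hw
    rw [mem_closedBall_zero_iff]
    have h1 : 0 ≤ 1 - ‖m' w‖ ^ 2 := by rw [hnsq w hw]; positivity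
    nlinarith [norm_nonneg (m' w)]
  have hmem0 : ∀ w : ℂ, w.im = 0 → m' w ∈ sphere (0 : ℂ) 1 := by
    intro w hw
    rw [mem_sphere_zero_iff_norm]
    have h1 := hnsq w hw.ge
    rw [hw, mul_zero, zero_div] at h1
    nlinarith [norm_nonneg (m' w)]
  have him : ∀ z : ℂ, z ≠ 1 → (m z).im = (1 - ‖z‖ ^ 2) / ‖1 - z‖ ^ 2 := by
    intro z hz
    have h1 : ‖1 - z‖ ≠ 0 := norm_ne_zero_iff.2 (sub_ne_zero.2 hz.symm)
    have h2 : m z =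
        ((Complex.I * (1 + z)) * (starRingEnd ℂ) (1 - z)) / ((‖1 - z‖ ^ 2 : ℝ) : ℂ) := by
      rw [← Complex.normSq_eq_norm_sq, ← Complex.mul_conj]
      have h3 : 1 - z ≠ 0 := sub_ne_zero.2 hz.symm
      have h4 : (starRingEnd ℂ) (1 - z) ≠ 0 := (map_ne_zero _).2 h3
      simp only [hm]
      field_simp
    rw [h2, Complex.div_ofReal_im, Complex.sq_norm z, Complex.normSq_apply]
    congr 1
    simp
    ring
  have key : ∀ A : ℂ → ℂ, ∀ B : ℂ → ℂ, ContinuousOn A (closedBall 0 1) →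
      MapsTo A (closedBall 0 1) (closedBall 0 1) → MapsTo A (sphere 0 1) (sphere 0 1) →
      (∀ z ∈ closedBall (0 : ℂ) 1, B (A z) = z) → B 1 = 1 →
      (∀ w : ℂ, 0 ≤ w.im → A (m' w) ≠ 1) ∧ ContinuousOn (fun w => m (A (m' w))) {w | 0 ≤ w.im} ∧
      (∀ w : ℂ, 0 ≤ w.im → 0 ≤ (m (A (m' w))).im) ∧
      (∀ w : ℂ, w.im = 0 → (m (A (m' w))).im = 0) := by
    intro A B hAc hAm hAs hBA hB1
    have h1 : ∀ w : ℂ, 0 ≤ w.im → A (m' w) ≠ 1 := by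
      intro w hw h
      have := hBA _ (hmem w hw)
      rw [h, hB1] at this
      exact hm'1 w hw this.symm
    refine ⟨h1, ?_, fun w hw => ?_, fun w hw => ?_⟩
    · have h2 : ContinuousOn m' {w | 0 ≤ w.im} :=
        ContinuousOn.div (by fun_prop) (by fun_prop) fun w hw => hden w hw
      have h3 : ContinuousOn (fun w => A (m' w)) {w | 0 ≤ w.im} := hAc.comp h2 fun w hw => hmem w hw
      exact ContinuousOn.div (continuousOn_const.mul (continuousOn_const.add h3))
        (continuousOn_const.sub h3) fun w hw => sub_ne_zero.2 (h1 w hw).symm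
    · rw [him _ (h1 w hw)]
      have h2 := mem_closedBall_zero_iff.1 (hAm (hmem w hw))
      have h3 : 0 ≤ 1 - ‖A (m' w)‖ ^ 2 := by nlinarith [norm_nonneg (A (m' w))]
      positivity
    · rw [him _ (h1 w hw.ge), mem_sphere_zero_iff_norm.1 (hAs (hmem0 w hw))]
      norm_num
  have hclosed : ∀ A : ℂ → ℂ, MapsTo A (ball 0 1) (ball 0 1) → MapsTo A (sphere 0 1) (sphere 0 1) →
      MapsTo A (closedBall 0 1) (closedBall 0 1) := by
    intro A h1 h2
    rw [← ball_union_sphere]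
    exact h1.union_union h2
  have h1mem : (1 : ℂ) ∈ closedBall (0 : ℂ) 1 := by simp
  have hΘ1 : Θ 1 = 1 := by
    have := hΘΨ 1 h1mem
    rwa [hΨ1] at this
  have hΨm := hclosed Ψ hΨb hΨs
  have hΘm := hclosed Θ hΘb hΘs
  obtain ⟨kA1, kA2, kA3, kA4⟩ := key Ψ Θ hΨ hΨm hΨs hΘΨ hΘ1
  obtain ⟨kB1, kB2, kB3, kB4⟩ := key Θ Ψ hΘ hΘm hΘs hΨΘ hΨ1
  obtain ⟨H, hH, hH'⟩ := exists_homeomorph_extending_halfPlane kA2 kB2 kA3 kB3 kA4 kB4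
    (fun w hw => by rw [hm'm _ (kA1 w hw), hΘΨ _ (hmem w hw), hmm' w hw])
    (fun w hw => by rw [hm'm _ (kB1 w hw), hΨΘ _ (hmem w hw), hmm' w hw])
  have hm0 : m 0 = Complex.I := by simp [hm]
  have hm'I : m' Complex.I = 0 := by simp [hm']
  have hId : Complex.I + Complex.I ≠ 0 := hden _ (by simp)
  have hm'an : AnalyticAt ℂ m' Complex.I := by
    refine AnalyticAt.div (by fun_prop) (by fun_prop) hId
  have hman : AnalyticAt ℂ m 0 := by
    refine AnalyticAt.div (by fun_prop) (by fun_prop) (by simp)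
  have hφan : AnalyticAt ℂ φ 0 := hφ.analyticAt (isOpen_ball.mem_nhds (mem_ball_self one_pos))
  have hcomp : HasDerivAt (fun z => m' (m z)) (deriv m' (m 0) * deriv m 0) 0 := by
    have h : HasDerivAt m' (deriv m' (m 0)) (m 0) := by
      rw [hm0]
      exact hm'an.differentiableAt.hasDerivAt
    exact h.comp (0 : ℂ) hman.differentiableAt.hasDerivAt
  have hid : HasDerivAt (fun z => m' (m z)) 1 0 := by
    refine (hasDerivAt_id (0 : ℂ)).congr_of_eventuallyEq ?_
    filter_upwards [isOpen_ne.mem_nhds (show (0 : ℂ) ≠ 1 from zero_ne_one)] with z hz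
    exact hm'm z hz
  have hprod := hcomp.unique hid
  have hd1 : deriv m' (m 0) ≠ 0 := left_ne_zero_of_mul (hprod ▸ one_ne_zero)
  have hd2 : deriv m 0 ≠ 0 := right_ne_zero_of_mul (hprod ▸ one_ne_zero)
  refine ⟨m, fun w => φ (m' w), H, hman, hd2, ?_, ?_, ?_, ?_, hH'⟩
  · rw [hm0, hH _ (by simp), hm'I, hΨ0, hm0]
  · rw [hm0]
    refine AnalyticAt.comp_of_eq ?_ hm'an rfl
    rwa [hm'I]
  · rw [hm0] at hd1 ⊢
    have h1 : HasDerivAt φ (deriv φ 0) (m' Complex.I) := by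
      rw [hm'I]; exact hφan.differentiableAt.hasDerivAt
    have h2 := h1.comp Complex.I hm'an.differentiableAt.hasDerivAt
    have h3 : deriv (fun w => φ (m' w)) Complex.I = deriv φ 0 * deriv m' Complex.I := h2.deriv
    rw [h3]
    exact mul_ne_zero hφ' hd1
  · filter_upwards [isOpen_ball.mem_nhds (mem_ball_self (x := (0 : ℂ)) one_pos)] with z hz
    have hz1 : z ≠ 1 := by
      rintro rfl
      simp at hz
    have hz2 : 0 ≤ (m z).im := by
      rw [him z hz1]
      have := mem_ball_zero_iff.1 hz
      have h3 : 0 ≤ 1 - ‖z‖ ^ 2 := by nlinarith [norm_nonneg z]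
      positivity
    have h4 := kA1 (m z) hz2
    rw [hm'm z hz1] at h4
    rw [hH _ hz2, hm'm z hz1, hm'm _ h4, hg z hz]

/-- The identity of `ℂ` plus a contraction is a homeomorphism. -/
theorem exists_homeomorph_add_of_lipschitz {h : ℂ → ℂ} {c : ℝ} (hc0 : 0 ≤ c) (hc : c < 1)
    (hh : ∀ x y, ‖h x - h y‖ ≤ c * ‖x - y‖) : ∃ Φ : ℂ ≃ₜ ℂ, ∀ z, Φ z = z + h z := by
  have hA : ApproximatesLinearOn (fun z => z + h z)
      ((ContinuousLinearEquiv.refl ℂ ℂ : ℂ ≃L[ℂ] ℂ) : ℂ →L[ℂ] ℂ) univ ⟨c, hc0⟩ := by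
    intro x _ y _
    have : x + h x - (y + h y) -
        ((ContinuousLinearEquiv.refl ℂ ℂ : ℂ ≃L[ℂ] ℂ) : ℂ →L[ℂ] ℂ) (x - y) = h x - h y := by
      simp
      ring
    simp only [this]
    exact hh x y
  refine ⟨hA.toHomeomorph _ (Or.inr ?_), fun z => rfl⟩
  have h1 : ‖((ContinuousLinearEquiv.refl ℂ ℂ).symm : ℂ →L[ℂ] ℂ)‖₊ = 1 := by
    rw [← NNReal.coe_inj]
    exact ContinuousLinearMap.norm_id
  rw [h1, inv_one]
  exact hc

/-- The radial cutoff equal to `1` on `closedBall p ρ` and `0` outside `ball p (2 * ρ)`. -/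
noncomputable def radialCutoff (p : ℂ) (ρ : ℝ) (z : ℂ) : ℝ := min 1 (max 0 (2 - ‖z - p‖ / ρ))

theorem radialCutoff_nonneg (p : ℂ) (ρ : ℝ) (z : ℂ) : 0 ≤ radialCutoff p ρ z :=
  le_min zero_le_one (le_max_left _ _)

theorem radialCutoff_le_one (p : ℂ) (ρ : ℝ) (z : ℂ) : radialCutoff p ρ z ≤ 1 := min_le_left _ _

theorem radialCutoff_eq_one {p : ℂ} {ρ : ℝ} {z : ℂ} (hρ : 0 < ρ) (hz : ‖z - p‖ ≤ ρ) :
    radialCutoff p ρ z = 1 := by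
  have : ‖z - p‖ / ρ ≤ 1 := (div_le_one hρ).2 hz
  exact min_eq_left (le_max_of_le_right (by linarith))

theorem radialCutoff_eq_zero {p : ℂ} {ρ : ℝ} {z : ℂ} (hρ : 0 < ρ) (hz : 2 * ρ ≤ ‖z - p‖) :
    radialCutoff p ρ z = 0 := by
  have : 2 ≤ ‖z - p‖ / ρ := (le_div_iff₀ hρ).2 hz
  rw [radialCutoff, max_eq_left (by linarith)]
  exact min_eq_right zero_le_one

theorem abs_radialCutoff_sub_le (p : ℂ) {ρ : ℝ} (hρ : 0 < ρ) (x y : ℂ) :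
    |radialCutoff p ρ x - radialCutoff p ρ y| ≤ ‖x - y‖ / ρ := by
  have h1 : |‖x - p‖ - ‖y - p‖| ≤ ‖x - y‖ := by
    simpa using abs_norm_sub_norm_le (x - p) (y - p)
  calc _ ≤ |max 0 (2 - ‖x - p‖ / ρ) - max 0 (2 - ‖y - p‖ / ρ)| := by
        simpa [radialCutoff] using abs_min_sub_min_le_max 1 (max 0 (2 - ‖x - p‖ / ρ)) 1
          (max 0 (2 - ‖y - p‖ / ρ))
    _ ≤ |(2 - ‖x - p‖ / ρ) - (2 - ‖y - p‖ / ρ)| := by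
        simpa using abs_max_sub_max_le_max 0 (2 - ‖x - p‖ / ρ) 0 (2 - ‖y - p‖ / ρ)
    _ = |‖x - p‖ - ‖y - p‖| / ρ := by
        rw [show (2 - ‖x - p‖ / ρ) - (2 - ‖y - p‖ / ρ) = -((‖x - p‖ - ‖y - p‖) / ρ) by ring,
          abs_neg, abs_div, abs_of_pos hρ]
    _ ≤ _ := by gcongr

/-- Truncating a small perturbation of the identity yields a homeomorphism. -/
theorem exists_homeomorph_truncation {f : ℂ → ℂ} {p : ℂ} {ρ L M : ℝ} (hρ : 0 < ρ) (hL : 0 ≤ L)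
    (hM : 0 ≤ M) (hc : L + M / ρ < 1)
    (hf : ∀ x ∈ closedBall p (2 * ρ), ∀ y ∈ closedBall p (2 * ρ), ‖f x - f y‖ ≤ L * ‖x - y‖)
    (hfM : ∀ x ∈ closedBall p (2 * ρ), ‖f x‖ ≤ M) :
    ∃ Φ : ℂ ≃ₜ ℂ, (∀ z, 2 * ρ ≤ ‖z - p‖ → Φ z = z) ∧ ∀ z, ‖z - p‖ ≤ ρ → Φ z = z + f z := by
  have hin : ∀ x ∈ closedBall p (2 * ρ), ∀ y, (radialCutoff p ρ y = 0 ∨ y ∈ closedBall p (2 * ρ)) →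
      ‖radialCutoff p ρ x * f x - radialCutoff p ρ y * f y‖ ≤ (L + M / ρ) * ‖x - y‖ := by
    intro x hx y hy
    have h1 : ‖((radialCutoff p ρ x - radialCutoff p ρ y : ℝ) : ℂ) * f x‖ ≤ M / ρ * ‖x - y‖ := by
      rw [norm_mul, Complex.norm_real, Real.norm_eq_abs]
      calc _ ≤ ‖x - y‖ / ρ * M := by
            gcongr
            · exact abs_radialCutoff_sub_le p hρ x y
            · exact hfM x hx
        _ = _ := by ring
    have h2 : ‖(radialCutoff p ρ y : ℂ) * (f x - f y)‖ ≤ L * ‖x - y‖ := by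
      rcases hy with hy | hy
      · simp only [hy, Complex.ofReal_zero, zero_mul, norm_zero]
        positivity
      · rw [norm_mul, Complex.norm_real, Real.norm_eq_abs,
          abs_of_nonneg (radialCutoff_nonneg _ _ _)]
        calc _ ≤ 1 * (L * ‖x - y‖) := by
              gcongr
              · exact radialCutoff_le_one _ _ _
              · exact hf x hx y hy
          _ = _ := one_mul _
    calc _ = ‖((radialCutoff p ρ x - radialCutoff p ρ y : ℝ) : ℂ) * f x +
          (radialCutoff p ρ y : ℂ) * (f x - f y)‖ := by
          congr 1
          push_cast
          ring
      _ ≤ M / ρ * ‖x - y‖ + L * ‖x - y‖ := (norm_add_le _ _).trans (add_le_add h1 h2)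
      _ = _ := by ring
  have hz : ∀ y, radialCutoff p ρ y = 0 ∨ y ∈ closedBall p (2 * ρ) := by
    intro y
    rcases le_total (2 * ρ) ‖y - p‖ with h | h
    · exact Or.inl (radialCutoff_eq_zero hρ h)
    · exact Or.inr (mem_closedBall_iff_norm.2 h)
  obtain ⟨Φ, hΦ⟩ := exists_homeomorph_add_of_lipschitz (h := fun z => radialCutoff p ρ z * f z)
    (c := L + M / ρ) (by positivity) hc (by
      intro x y
      rcases hz x with hx | hx
      · rcases hz y with hy | hy
        · simp only [hx, hy, Complex.ofReal_zero, zero_mul, sub_zero, norm_zero]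
          positivity
        · rw [norm_sub_rev, norm_sub_rev x]
          exact hin y hy x (Or.inl hx)
      · exact hin x hx y (hz y))
  refine ⟨Φ, fun z h => ?_, fun z h => ?_⟩
  · rw [hΦ, radialCutoff_eq_zero hρ h]
    simp
  · rw [hΦ, radialCutoff_eq_one hρ h]
    simp

/-- The germ of `φ` at `p` is realised by a homeomorphism of `ℂ` with bounded support. -/
def HasHomeomorphGerm (φ : ℂ → ℂ) (p : ℂ) : Prop :=
  ∃ Φ : ℂ ≃ₜ ℂ, (∃ R : ℝ, ∀ z, R ≤ ‖z‖ → Φ z = z) ∧ Φ =ᶠ[𝓝 p] φ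

theorem HasHomeomorphGerm.congr {φ ψ : ℂ → ℂ} {p : ℂ} (h : HasHomeomorphGerm φ p)
    (hψ : φ =ᶠ[𝓝 p] ψ) : HasHomeomorphGerm ψ p := by
  obtain ⟨Φ, h1, h2⟩ := h
  exact ⟨Φ, h1, h2.trans hψ⟩

theorem HasHomeomorphGerm.comp {φ ψ : ℂ → ℂ} {p q : ℂ} (hψ : HasHomeomorphGerm ψ q)
    (hφ : HasHomeomorphGerm φ p) (hq : φ p = q) : HasHomeomorphGerm (fun z => ψ (φ z)) p := by
  obtain ⟨Ψ, ⟨R, hR⟩, hΨ⟩ := hψ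
  obtain ⟨Φ, ⟨R', hR'⟩, hΦ⟩ := hφ
  refine ⟨Φ.trans Ψ, ⟨max R R', fun z hz => ?_⟩, ?_⟩
  · rw [Homeomorph.trans_apply, hR' z ((le_max_right _ _).trans hz),
      hR z ((le_max_left _ _).trans hz)]
  · have h1 : Tendsto Φ (𝓝 p) (𝓝 q) := by
      rw [← hq, ← hΦ.self_of_nhds]
      exact Φ.continuous.continuousAt
    filter_upwards [h1.eventually hΨ, hΦ] with z h2 h3
    rw [Homeomorph.trans_apply, h2, h3]

theorem hasHomeomorphGerm_add (v p : ℂ) : HasHomeomorphGerm (fun z => z + v) p := by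
  have hρ : 0 < 2 * ‖v‖ + 1 := by positivity
  obtain ⟨Φ, h1, h2⟩ := exists_homeomorph_truncation (f := fun _ => v) (p := p)
    (ρ := 2 * ‖v‖ + 1) (L := 0) (M := ‖v‖) hρ le_rfl (norm_nonneg _)
    (by rw [zero_add, div_lt_one hρ]; linarith [norm_nonneg v]) (by simp) (by simp)
  refine ⟨Φ, ⟨2 * (2 * ‖v‖ + 1) + ‖p‖, fun z hz => h1 z ?_⟩, ?_⟩
  · linarith [norm_sub_norm_le z p]
  · filter_upwards [closedBall_mem_nhds p hρ] with z hz
    exact h2 z (mem_closedBall_iff_norm.1 hz)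

theorem hasHomeomorphGerm_of_deriv_near_one {φ : ℂ → ℂ} {a : ℂ} (h0 : φ 0 = 0)
    (hφ : HasStrictDerivAt φ a 0) (ha : ‖a - 1‖ < 1 / 4) : HasHomeomorphGerm φ 0 := by
  have h1 : HasStrictDerivAt (fun z => φ z - z) (a - 1) 0 := hφ.sub (hasStrictDerivAt_id 0)
  obtain ⟨s, hs, hLs⟩ := h1.hasStrictFDerivAt.exists_lipschitzOnWith_of_nnnorm_lt (1 / 4) (by
    rw [← NNReal.coe_lt_coe]
    simpa using ha)
  obtain ⟨r, hr, hrs⟩ := Metric.nhds_basis_closedBall.mem_iff.1 hs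
  have hρ : 0 < r / 2 := by positivity
  have hr2 : 2 * (r / 2) = r := by ring
  have hlip : ∀ x ∈ closedBall (0 : ℂ) r, ∀ y ∈ closedBall (0 : ℂ) r,
      ‖(φ x - x) - (φ y - y)‖ ≤ 1 / 4 * ‖x - y‖ := by
    intro x hx y hy
    have := hLs.dist_le_mul x (hrs hx) y (hrs hy)
    rw [dist_eq_norm, dist_eq_norm] at this
    simpa using this
  obtain ⟨Φ, h2, h3⟩ := exists_homeomorph_truncation (f := fun z => φ z - z) (p := 0)
    (ρ := r / 2) (L := 1 / 4) (M := r / 4) hρ (by norm_num) (by positivity)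
    (by rw [show r / 4 / (r / 2) = 1 / 2 by field_simp; norm_num]; norm_num)
    (by rw [hr2]; exact hlip) (by
      rw [hr2]
      intro x hx
      have := hlip x hx 0 (mem_closedBall_self hr.le)
      simp only [h0, sub_zero] at this
      have h4 := mem_closedBall_zero_iff.1 hx
      linarith)
  refine ⟨Φ, ⟨r, fun z hz => h2 z (by rwa [hr2, sub_zero])⟩, ?_⟩
  filter_upwards [closedBall_mem_nhds (0 : ℂ) hρ] with z hz
  rw [h3 z (mem_closedBall_iff_norm.1 hz)]
  ring

theorem hasHomeomorphGerm_mul {a : ℂ} (ha : a ≠ 0) : HasHomeomorphGerm (fun z => a * z) 0 := by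
  have h1 : Tendsto (fun n : ℕ => Complex.exp (Complex.log a / n)) atTop (𝓝 1) := by
    have h2 : Tendsto (fun n : ℕ => Complex.log a / n) atTop (𝓝 0) :=
      tendsto_const_div_atTop_nhds_zero_nat _
    simpa [Function.comp_def] using (Complex.continuous_exp.tendsto 0).comp h2
  obtain ⟨n, hn, hn0⟩ := ((h1.eventually (ball_mem_nhds 1 (show (0 : ℝ) < 1 / 4 by norm_num))).and
    (eventually_gt_atTop 0)).exists
  set b := Complex.exp (Complex.log a / n) with hb
  have hbn : b ^ n = a := by
    rw [hb, ← Complex.exp_nat_mul, mul_div_cancel₀ _ (by exact_mod_cast hn0.ne'),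
      Complex.exp_log ha]
  have hg : HasHomeomorphGerm (fun z => b * z) 0 :=
    hasHomeomorphGerm_of_deriv_near_one (a := b) (mul_zero b)
      (by simpa using (hasStrictDerivAt_id (0 : ℂ)).const_mul b) (mem_ball_iff_norm.1 hn)
  have hpow : ∀ k : ℕ, HasHomeomorphGerm (fun z => b ^ k * z) 0 := by
    intro k
    induction k with
    | zero => exact ⟨Homeomorph.refl ℂ, ⟨0, fun z _ => rfl⟩, Eventually.of_forall fun z => by simp⟩
    | succ k ih =>
      refine (hg.comp ih (mul_zero _)).congr (Eventually.of_forall fun z => ?_)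
      change b * (b ^ k * z) = b ^ (k + 1) * z
      ring
  rw [← hbn]
  exact hpow n

/-- Conformal germs are realised by homeomorphisms with bounded support. -/
theorem hasHomeomorphGerm_of_analyticAt {φ : ℂ → ℂ} {p : ℂ} (hφ : AnalyticAt ℂ φ p)
    (hd : deriv φ p ≠ 0) : HasHomeomorphGerm φ p := by
  set a := deriv φ p with ha
  have h1 : HasStrictDerivAt φ a (0 + p) := by
    rw [zero_add]
    exact hφ.hasStrictDerivAt
  have h2 : HasStrictDerivAt (fun z => a⁻¹ * (φ (z + p) - φ p)) 1 0 := by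
    have h3 : HasStrictDerivAt (fun z => φ (z + p)) a 0 := by
      simpa [Function.comp_def] using h1.comp (0 : ℂ) ((hasStrictDerivAt_id (0 : ℂ)).add_const p)
    have h4 : HasStrictDerivAt (fun z => φ (z + p) - φ p) a 0 := h3.sub_const (φ p)
    simpa [hd] using h4.const_mul a⁻¹
  have h3 := hasHomeomorphGerm_of_deriv_near_one (a := 1) (by simp) h2 (by norm_num)
  have h4 := (hasHomeomorphGerm_mul hd).comp h3 (by simp)
  have h5 := h4.comp (hasHomeomorphGerm_add (-p) p) (by simp)
  have h6 := (hasHomeomorphGerm_add (φ p) 0).comp h5 (by simp)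
  refine h6.congr (Eventually.of_forall fun z => ?_)
  change a * (a⁻¹ * (φ (z + -p + p) - φ p)) + φ p = φ z
  rw [mul_inv_cancel_left₀ hd]
  simp

/-- The unit disc can be shrunk into any disc centred in it, with support in a fixed disc. -/
theorem exists_homeomorph_shrinking {x : ℂ} (hx : ‖x‖ < 1) {ε : ℝ} (hε : 0 < ε) :
    ∃ Φ : ℂ ≃ₜ ℂ, (∀ z, 5 ≤ ‖z‖ → Φ z = z) ∧ ∀ z, ‖z‖ < 1 → Φ z ∈ ball x ε := by
  obtain ⟨κ, h1, h2⟩ := exists_homeomorph_truncation (f := fun z => -(1 / 8) * (z - x)) (p := x)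
    (ρ := 2) (L := 1 / 8) (M := 1 / 2) (by norm_num) (by norm_num) (by norm_num) (by norm_num)
    (by
      intro y _ z _
      rw [show -(1 / 8) * (y - x) - -(1 / 8) * (z - x) = -(1 / 8) * (y - z) by ring, norm_mul]
      norm_num)
    (by
      intro y hy
      have := mem_closedBall_iff_norm.1 hy
      rw [norm_mul]
      norm_num
      linarith)
  have hκ : ∀ z, ‖z - x‖ ≤ 2 → κ z - x = (7 / 8) * (z - x) := by
    intro z hz
    rw [h2 z hz]
    ring
  have hiter : ∀ n : ℕ, ∃ Φ : ℂ ≃ₜ ℂ, (∀ z, 5 ≤ ‖z‖ → Φ z = z) ∧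
      ∀ z, ‖z - x‖ ≤ 2 → Φ z - x = (7 / 8) ^ n * (z - x) := by
    intro n
    induction n with
    | zero => exact ⟨Homeomorph.refl ℂ, fun z _ => rfl, fun z _ => by simp⟩
    | succ n ih =>
      obtain ⟨Φ, h3, h4⟩ := ih
      refine ⟨κ.trans Φ, fun z hz => ?_, fun z hz => ?_⟩
      · rw [Homeomorph.trans_apply, h1 z (by linarith [norm_sub_norm_le z x]), h3 z hz]
      · have h5 := hκ z hz
        rw [Homeomorph.trans_apply, h4 _ ?_, h5]
        · ring
        · rw [h5, norm_mul]
          norm_num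
          linarith [norm_nonneg (z - x)]
  obtain ⟨n, hn⟩ := exists_pow_lt_of_lt_one (show 0 < ε / 2 by positivity)
    (show (7 / 8 : ℝ) < 1 by norm_num)
  obtain ⟨Φ, h3, h4⟩ := hiter n
  refine ⟨Φ, h3, fun z hz => ?_⟩
  have h5 : ‖z - x‖ ≤ 2 := (norm_sub_le z x).trans (by linarith)
  rw [mem_ball_iff_norm, h4 z h5, norm_mul, norm_pow]
  norm_num at hn ⊢
  nlinarith [norm_nonneg (z - x), show (0 : ℝ) < (7 / 8) ^ n by positivity]

/-- Sequences in `A` are words of controlled length in boundedly many elements of `G`. -/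
def UniformlyDistorted {G : Type*} [Group G] (A : Set G) : Prop :=
  ∃ (m : ℕ) (w : ℕ → ℕ), ∀ a : ℕ → G, (∀ n, a n ∈ A) → ∃ S : Set G,
    S.Finite ∧ S.ncard ≤ m ∧ ∀ n, a n ∈ S ^ w n

namespace UniformlyDistorted

variable {G H : Type*} [Group G] [Group H] {A B : Set G}

theorem mono (hB : UniformlyDistorted B) (h : A ⊆ B) : UniformlyDistorted A := by
  obtain ⟨m, w, hw⟩ := hB
  exact ⟨m, w, fun a ha => hw a fun n => h (ha n)⟩

protected theorem mul (hA : UniformlyDistorted A) (hB : UniformlyDistorted B) :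
    UniformlyDistorted (A * B) := by
  obtain ⟨m, w, hA⟩ := hA
  obtain ⟨m', w', hB⟩ := hB
  refine ⟨m + m', fun n => w n + w' n, fun a ha => ?_⟩
  choose b hb c hc hbc using fun n => Set.mem_mul.1 (ha n)
  obtain ⟨S, hS, hSm, hSw⟩ := hA b hb
  obtain ⟨T, hT, hTm, hTw⟩ := hB c hc
  refine ⟨S ∪ T, hS.union hT, (ncard_union_le S T).trans (add_le_add hSm hTm), fun n => ?_⟩
  rw [← hbc n, pow_add]
  exact mul_mem_mul (pow_subset_pow_left subset_union_left (hSw n))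
    (pow_subset_pow_left subset_union_right (hTw n))

theorem of_finite (hA : A.Finite) : UniformlyDistorted A :=
  ⟨A.ncard, fun _ => 1, fun a ha => ⟨A, hA, le_rfl, fun n => by simpa using ha n⟩⟩

theorem image (hA : UniformlyDistorted A) (f : G →* H) : UniformlyDistorted (f '' A) := by
  obtain ⟨m, w, hA⟩ := hA
  refine ⟨m, w, fun a ha => ?_⟩
  choose b hb hba using ha
  obtain ⟨S, hS, hSm, hSw⟩ := hA b hb
  refine ⟨f '' S, hS.image f, (ncard_image_le hS).trans hSm, fun n => ?_⟩
  rw [← hba n, ← Set.image_pow]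
  exact mem_image_of_mem f (hSw n)

theorem stronglyDistorted [Infinite G] (hG : UniformlyDistorted (univ : Set G)) :
    StronglyDistorted G := by
  obtain ⟨m, w, hG⟩ := hG
  refine ⟨m, w, fun g => ?_⟩
  obtain ⟨S, hS, hSm, hSw⟩ := hG g fun n => mem_univ _
  obtain ⟨T, hST, hT⟩ := Infinite.exists_superset_card_eq hS.toFinset m
    (by rwa [← ncard_eq_toFinset_card S hS])
  refine ⟨T, T.finite_toSet, by rw [ncard_coe_finset, hT], fun n => ?_⟩
  exact pow_subset_pow_left (fun x hx => hST (hS.mem_toFinset.2 hx)) (hSw n)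

end UniformlyDistorted

/-- The homeomorphisms of `ℂ` that fix every point outside the disc of radius `5`. -/
def discHomeos : Subgroup (ℂ ≃ₜ ℂ) where
  carrier := {f | ∀ z, 5 ≤ ‖z‖ → f z = z}
  mul_mem' {f g} hf hg z hz := by
    change f (g z) = z
    rw [hg z hz, hf z hz]
  one_mem' _ _ := rfl
  inv_mem' {f} hf z hz := f.symm_apply_eq.2 (hf z hz).symm

theorem discHomeos_apply (f : discHomeos) {z : ℂ} (hz : 5 ≤ ‖z‖) : (f : ℂ ≃ₜ ℂ) z = z := f.2 z hz

theorem norm_discHomeos_apply_lt (f : discHomeos) {z : ℂ} {r : ℝ} (hr : 5 ≤ r) (hz : ‖z‖ < r) :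
    ‖(f : ℂ ≃ₜ ℂ) z‖ < r := by
  by_contra! h
  have h1 := (f : ℂ ≃ₜ ℂ).injective (discHomeos_apply f (hr.trans h))
  rw [h1] at h
  exact h.not_gt hz

theorem norm_discHomeos_apply_le (f : discHomeos) {z : ℂ} (hz : ‖z‖ ≤ 5) :
    ‖(f : ℂ ≃ₜ ℂ) z‖ ≤ 5 := by
  refine le_of_forall_gt_imp_ge_of_dense fun r hr => ?_
  exact (norm_discHomeos_apply_lt f hr.le (hz.trans_lt hr)).le

/-- The points of the square lattice with mesh `15`. -/
noncomputable def latticePoint (i : ℤ × ℤ) : ℂ := ⟨15 * i.1, 15 * i.2⟩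

/-- The index of a lattice point nearest to `z`. -/
noncomputable def latticeCell (z : ℂ) : ℤ × ℤ := (round (z.re / 15), round (z.im / 15))

theorem latticeCell_eq {z : ℂ} {i : ℤ × ℤ} (h : ‖z - latticePoint i‖ < 15 / 2) :
    latticeCell z = i := by
  have key : ∀ (x : ℝ) (n : ℤ), |x - 15 * n| < 15 / 2 → round (x / 15) = n := by
    intro x n hx
    have h1 := abs_sub_round (x / 15)
    have h2 : |x / 15 - n| < 1 / 2 := by
      rw [show x / 15 - n = (x - 15 * n) / 15 by ring, abs_div,
        abs_of_pos (by norm_num : (0 : ℝ) < 15)]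
      linarith
    have h3 : |((round (x / 15) - n : ℤ) : ℝ)| < 1 := by
      push_cast
      rw [abs_le] at h1
      rw [abs_lt] at h2 ⊢
      constructor <;> linarith
    have h4 : |round (x / 15) - n| < 1 := by exact_mod_cast h3
    have := Int.abs_lt_one_iff.1 h4
    lia
  refine Prod.ext (key _ _ ?_) (key _ _ ?_)
  · exact (Complex.abs_re_le_norm (z - latticePoint i)).trans_lt h
  · exact (Complex.abs_im_le_norm (z - latticePoint i)).trans_lt h

/-- A family of homeomorphisms of the disc, transplanted to the discs around lattice points. -/
noncomputable def latticeMap (b : ℤ × ℤ → discHomeos) (z : ℂ) : ℂ :=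
  latticePoint (latticeCell z) + (b (latticeCell z) : ℂ ≃ₜ ℂ) (z - latticePoint (latticeCell z))

theorem latticeMap_of_lt (b : ℤ × ℤ → discHomeos) {z : ℂ} {i : ℤ × ℤ}
    (h : ‖z - latticePoint i‖ < 15 / 2) :
    latticeMap b z = latticePoint i + (b i : ℂ ≃ₜ ℂ) (z - latticePoint i) := by
  rw [latticeMap, latticeCell_eq h]

theorem latticeMap_of_le (b : ℤ × ℤ → discHomeos) {z : ℂ} (h : ∀ i, 5 ≤ ‖z - latticePoint i‖) :
    latticeMap b z = z := by
  rw [latticeMap, discHomeos_apply _ (h _)]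
  ring

theorem latticeMap_mul (b b' : ℤ × ℤ → discHomeos) (z : ℂ) :
    latticeMap (b * b') z = latticeMap b (latticeMap b' z) := by
  by_cases h : ∀ i, 5 ≤ ‖z - latticePoint i‖
  · rw [latticeMap_of_le b' h, latticeMap_of_le _ h, latticeMap_of_le _ h]
  · push Not at h
    obtain ⟨i, hi⟩ := h
    have h1 : ‖z - latticePoint i‖ < 15 / 2 := by linarith
    have h2 := norm_discHomeos_apply_lt (b' i) (r := 15 / 2) (by norm_num) h1
    rw [latticeMap_of_lt b' h1, latticeMap_of_lt _ h1, latticeMap_of_lt b (i := i)]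
    · rw [add_sub_cancel_left]
      rfl
    · rwa [add_sub_cancel_left]

theorem latticeMap_one (z : ℂ) : latticeMap 1 z = z := by
  change latticePoint (latticeCell z) + (z - latticePoint (latticeCell z)) = z
  ring

theorem continuous_latticeMap (b : ℤ × ℤ → discHomeos) : Continuous (latticeMap b) := by
  rw [continuous_iff_continuousAt]
  intro z
  by_cases h : ∀ i, 6 ≤ ‖z - latticePoint i‖
  · refine continuousAt_id.congr_of_eventuallyEq ?_
    filter_upwards [ball_mem_nhds z one_pos] with y hy
    refine latticeMap_of_le b fun i => ?_
    have h1 := norm_sub_le_norm_sub_add_norm_sub z y (latticePoint i)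
    have h2 := h i
    rw [mem_ball_iff_norm, norm_sub_rev] at hy
    linarith
  · push Not at h
    obtain ⟨i, hi⟩ := h
    have h1 : ContinuousAt (fun z => latticePoint i + (b i : ℂ ≃ₜ ℂ) (z - latticePoint i)) z := by
      have := (b i : ℂ ≃ₜ ℂ).continuous
      fun_prop
    refine h1.congr_of_eventuallyEq ?_
    filter_upwards [isOpen_ball.mem_nhds (mem_ball_iff_norm.2 hi)] with y hy
    rw [mem_ball_iff_norm] at hy
    exact latticeMap_of_lt b (by linarith)

/-- Transplanting families of homeomorphisms of the disc to the lattice discs, as a group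
homomorphism. -/
noncomputable def latticeHom : (ℤ × ℤ → discHomeos) →* (ℂ ≃ₜ ℂ) where
  toFun b :=
    { toFun := latticeMap b
      invFun := latticeMap b⁻¹
      left_inv := fun z => by rw [← latticeMap_mul, inv_mul_cancel, latticeMap_one]
      right_inv := fun z => by rw [← latticeMap_mul, mul_inv_cancel, latticeMap_one]
      continuous_toFun := continuous_latticeMap b
      continuous_invFun := continuous_latticeMap b⁻¹ }
  map_one' := Homeomorph.ext latticeMap_one
  map_mul' b b' := Homeomorph.ext (latticeMap_mul b b')

theorem latticeHom_apply (b : ℤ × ℤ → discHomeos) (z : ℂ) : latticeHom b z = latticeMap b z := rfl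

/-- A homeomorphism permuting the lattice discs by translations permutes transplanted families. -/
theorem latticeHom_conj {h : ℂ ≃ₜ ℂ} {σ : Equiv.Perm (ℤ × ℤ)}
    (hσ : ∀ i w, ‖w‖ ≤ 5 → h (latticePoint i + w) = latticePoint (σ i) + w)
    (b : ℤ × ℤ → discHomeos) :
    h * latticeHom b * h⁻¹ = latticeHom fun i => b (σ.symm i) := by
  rw [mul_inv_eq_iff_eq_mul]
  ext1 z
  change h (latticeMap b z) = latticeMap (fun i => b (σ.symm i)) (h z)
  by_cases hz : ∀ i, 5 ≤ ‖z - latticePoint i‖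
  · rw [latticeMap_of_le b hz, latticeMap_of_le]
    intro j
    by_contra! hj
    have h1 := hσ (σ.symm j) _ hj.le
    rw [Equiv.apply_symm_apply, add_sub_cancel] at h1
    have h2 := hz (σ.symm j)
    rw [← h.injective h1, add_sub_cancel_left] at h2
    exact h2.not_gt hj
  · push Not at hz
    obtain ⟨i, hi⟩ := hz
    have h1 := hσ i _ hi.le
    rw [add_sub_cancel] at h1
    rw [latticeMap_of_lt b (i := i) (by linarith),
      hσ i _ (norm_discHomeos_apply_le _ hi.le), latticeMap_of_lt _ (i := σ i), h1,
      add_sub_cancel_left, Equiv.symm_apply_apply]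
    rw [h1, add_sub_cancel_left]
    linarith

theorem latticeHom_mulSingle_zero (f : discHomeos) :
    latticeHom (Pi.mulSingle 0 f) = (f : ℂ ≃ₜ ℂ) := by
  have h0 : latticePoint 0 = 0 := by simp [latticePoint, Complex.ext_iff]
  ext1 z
  rw [latticeHom_apply]
  by_cases hz : ‖z‖ < 15 / 2
  · rw [latticeMap_of_lt _ (i := 0) (by rwa [h0, sub_zero]), h0, zero_add, sub_zero,
      Pi.mulSingle_eq_same]
  · push Not at hz
    rw [discHomeos_apply f (by linarith)]
    by_cases hc : latticeCell z = 0
    · rw [latticeMap, hc, h0, zero_add, sub_zero, Pi.mulSingle_eq_same,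
        discHomeos_apply f (by linarith)]
    · rw [latticeMap, Pi.mulSingle_eq_of_ne hc]
      change latticePoint (latticeCell z) + (z - latticePoint (latticeCell z)) = z
      ring

/-- A shear that moves up the column of lattice discs over `0` and fixes the other ones. -/
theorem exists_column_shift : ∃ T : ℂ ≃ₜ ℂ, ∃ σ : Equiv.Perm (ℤ × ℤ),
    (∀ i w, ‖w‖ ≤ 5 → T (latticePoint i + w) = latticePoint (σ i) + w) ∧
    (∀ k, σ.symm (0, k) = (0, k - 1)) ∧ ∀ j k, j ≠ 0 → σ.symm (j, k) = (j, k) := by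
  let χ : ℝ → ℝ := fun x => max 0 (min 1 ((10 - |x|) / 5))
  have hχ : Continuous χ := by fun_prop
  let T : ℂ ≃ₜ ℂ :=
    { toFun := fun z => z + ((15 * χ z.re : ℝ) : ℂ) * Complex.I
      invFun := fun z => z - ((15 * χ z.re : ℝ) : ℂ) * Complex.I
      left_inv := fun z => by simp
      right_inv := fun z => by simp
      continuous_toFun := by fun_prop
      continuous_invFun := by fun_prop }
  let σ : Equiv.Perm (ℤ × ℤ) :=
    { toFun := fun i => if i.1 = 0 then (i.1, i.2 + 1) else i
      invFun := fun i => if i.1 = 0 then (i.1, i.2 - 1) else i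
      left_inv := fun i => by by_cases h : i.1 = 0 <;> simp [h, Prod.ext_iff]
      right_inv := fun i => by by_cases h : i.1 = 0 <;> simp [h, Prod.ext_iff] }
  refine ⟨T, σ, fun i w hw => ?_, fun k => rfl,
    fun j k hj => if_neg hj⟩
  have hre : |w.re| ≤ 5 := (Complex.abs_re_le_norm w).trans hw
  change latticePoint i + w + ((15 * χ (latticePoint i + w).re : ℝ) : ℂ) * Complex.I =
    latticePoint (if i.1 = 0 then (i.1, i.2 + 1) else i) + w
  by_cases hi : i.1 = 0
  · have h1 : χ (latticePoint i + w).re = 1 := by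
      have h2 : (latticePoint i + w).re = w.re := by simp [latticePoint, hi]
      have h3 : 1 ≤ (10 - |w.re|) / 5 := by linarith
      simp only [χ, h2, min_eq_left h3]
      norm_num
    rw [h1, if_pos hi]
    apply Complex.ext
    · simp [latticePoint]
    · simp [latticePoint]
      ring
  · have h1 : χ (latticePoint i + w).re = 0 := by
      have h2 : (1 : ℝ) ≤ |(i.1 : ℝ)| := by exact_mod_cast Int.one_le_abs hi
      have h3 : 10 ≤ |(latticePoint i + w).re| := by
        have h4 : (latticePoint i + w).re = 15 * i.1 - -w.re := by simp [latticePoint]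
        have h5 := abs_sub_abs_le_abs_sub (15 * (i.1 : ℝ)) (-w.re)
        rw [abs_neg, abs_mul, abs_of_pos (by norm_num : (0 : ℝ) < 15)] at h5
        rw [h4]
        linarith
      have h6 : (10 - |(latticePoint i + w).re|) / 5 ≤ 0 := by linarith
      simp only [χ, min_eq_right (h6.trans zero_le_one), max_eq_left h6]
    rw [h1, if_neg hi]
    simp

theorem uniformlyDistorted_discHomeos : UniformlyDistorted (discHomeos : Set (ℂ ≃ₜ ℂ)) := by
  obtain ⟨T, σ, hT, hσ0, hσ1⟩ := exists_column_shift
  let X : ℂ ≃ₜ ℂ := Homeomorph.addRight (15 : ℂ)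
  let τ : Equiv.Perm (ℤ × ℤ) := (Equiv.addRight (1 : ℤ)).prodCongr (Equiv.refl ℤ)
  have hX : ∀ i w, ‖w‖ ≤ 5 → X (latticePoint i + w) = latticePoint (τ i) + w := by
    intro i w _
    change latticePoint i + w + 15 = latticePoint (i.1 + 1, i.2) + w
    apply Complex.ext
    · simp [latticePoint]
      ring
    · simp [latticePoint]
  refine ⟨6, fun n => n + 1 + n + 1 + n + 1 + n + 1, fun a ha => ?_⟩
  let b : ℤ × ℤ → discHomeos := fun i =>
    if 0 ≤ i.1 ∧ 0 ≤ i.2 then ⟨a i.1.toNat, ha _⟩ else 1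
  let A := latticeHom b
  refine ⟨{A, A⁻¹, X, X⁻¹, T, T⁻¹}, by simp, ?_, fun n => ?_⟩
  · refine (ncard_insert_le _ _).trans ?_
    refine Nat.succ_le_succ ((ncard_insert_le _ _).trans ?_)
    refine Nat.succ_le_succ ((ncard_insert_le _ _).trans ?_)
    refine Nat.succ_le_succ ((ncard_insert_le _ _).trans ?_)
    refine Nat.succ_le_succ ((ncard_insert_le _ _).trans ?_)
    simp
  have hXn : ∀ n : ℕ, X⁻¹ ^ n * A * X ^ n = latticeHom fun i => b (i.1 + n, i.2) := by
    intro n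
    induction n with
    | zero => simp [A]
    | succ n ih =>
      rw [pow_succ', pow_succ, show X⁻¹ * X⁻¹ ^ n * A * (X ^ n * X) =
        X⁻¹ * (X⁻¹ ^ n * A * X ^ n) * X by group, ih, ← eq_mul_inv_iff_mul_eq,
        inv_mul_eq_iff_eq_mul, ← mul_assoc, latticeHom_conj hX]
      congr 1
      funext i
      change b (i.1 + n, i.2) = b (i.1 + -1 + ((n + 1 : ℕ) : ℤ), i.2)
      congr 2
      push_cast
      ring
  have hword : a n = X⁻¹ ^ n * A * X ^ n * T * X⁻¹ ^ n * A⁻¹ * X ^ n * T⁻¹ := by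
    have h1 : (X⁻¹ ^ n * A * X ^ n) * (T * (X⁻¹ ^ n * A * X ^ n)⁻¹ * T⁻¹) = a n := by
      rw [hXn, ← map_inv, latticeHom_conj hT, ← map_mul]
      refine Eq.trans (congrArg latticeHom ?_) (latticeHom_mulSingle_zero ⟨a n, ha n⟩)
      funext ⟨j, k⟩
      by_cases hj : j = 0
      · subst hj
        simp only [Pi.mul_apply, Pi.inv_apply, hσ0, zero_add]
        rcases lt_trichotomy k 0 with hk | rfl | hk
        · have h2 : ¬ (0 ≤ k) := by lia
          have h3 : ¬ (1 ≤ k) := by lia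
          have h4 : ((0 : ℤ), k) ≠ 0 := by simp [Prod.ext_iff, hk.ne]
          simp [b, h2, h3, Pi.mulSingle_eq_of_ne h4]
        · simp only [b]
          rw [if_pos ⟨by simp, le_rfl⟩, if_neg (by simp)]
          simp only [Int.toNat_natCast, inv_one, mul_one]
          exact (Pi.mulSingle_eq_same (M := fun _ : ℤ × ℤ => discHomeos) 0 _).symm
        · have h2 : 0 ≤ k := hk.le
          have h3 : 1 ≤ k := by lia
          have h4 : ((0 : ℤ), k) ≠ 0 := by simp [Prod.ext_iff, hk.ne']
          simp [b, h2, h3, Pi.mulSingle_eq_of_ne h4]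
      · have h4 : (j, k) ≠ (0 : ℤ × ℤ) := by simp [Prod.ext_iff, hj]
        simp [hσ1 j k hj, Pi.mulSingle_eq_of_ne h4]
    rw [← h1]
    group
  rw [hword]
  simp only [pow_add, pow_one]
  refine mul_mem_mul (mul_mem_mul (mul_mem_mul (mul_mem_mul (mul_mem_mul (mul_mem_mul
    (mul_mem_mul (pow_mem_pow ?_) ?_) (pow_mem_pow ?_)) ?_) (pow_mem_pow ?_)) ?_)
    (pow_mem_pow ?_)) ?_ <;> simp

/-- Extension of homeomorphisms of `ℂ` to the Riemann sphere. -/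
noncomputable def extendHom : (ℂ ≃ₜ ℂ) →* (OnePoint ℂ ≃ₜ OnePoint ℂ) where
  toFun f := f.onePointCongr
  map_one' := Homeomorph.ext fun x => by induction x <;> rfl
  map_mul' f g := Homeomorph.ext fun x => by induction x <;> rfl

theorem extendHom_coe (f : ℂ ≃ₜ ℂ) (z : ℂ) : extendHom f (z : OnePoint ℂ) = (f z : ℂ) := rfl

theorem exists_extendHom_eq {g : OnePoint ℂ ≃ₜ OnePoint ℂ}
    (hg : g OnePoint.infty = OnePoint.infty) :
    ∃ f : ℂ ≃ₜ ℂ, extendHom f = g := by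
  have key : ∀ g : OnePoint ℂ ≃ₜ OnePoint ℂ, g OnePoint.infty = OnePoint.infty →
      ∃ f : ℂ → ℂ, Continuous f ∧ ∀ z : ℂ, (f z : OnePoint ℂ) = g z := by
    intro g hg
    have h1 : ∀ z : ℂ, ∃ w : ℂ, (w : OnePoint ℂ) = g z := fun z =>
      OnePoint.ne_infty_iff_exists.1 fun h =>
        OnePoint.coe_ne_infty z (g.injective (h.trans hg.symm))
    choose f hf using h1
    refine ⟨f, ?_, hf⟩
    rw [OnePoint.isOpenEmbedding_coe.isInducing.continuous_iff]
    exact (g.continuous.comp OnePoint.continuous_coe).congr fun z => (hf z).symm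
  obtain ⟨f, hfc, hf⟩ := key g hg
  obtain ⟨f', hfc', hf'⟩ := key g.symm (g.symm_apply_eq.2 hg.symm)
  refine ⟨⟨⟨f, f', fun z => ?_, fun z => ?_⟩, hfc, hfc'⟩, ?_⟩
  · apply OnePoint.coe_injective
    rw [hf', hf, g.symm_apply_apply]
  · apply OnePoint.coe_injective
    rw [hf, hf', g.apply_symm_apply]
  · ext1 x
    induction x with
    | infty => exact hg.symm
    | coe z => exact hf z

/-- The inversion `z ↦ 1 / z` of the Riemann sphere. -/
noncomputable def sphereInv (x : OnePoint ℂ) : OnePoint ℂ :=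
  x.elim ((0 : ℂ) : OnePoint ℂ) fun z => if z = 0 then OnePoint.infty else ((z⁻¹ : ℂ) : OnePoint ℂ)

theorem sphereInv_zero : sphereInv ((0 : ℂ) : OnePoint ℂ) = OnePoint.infty := if_pos rfl

theorem sphereInv_infty : sphereInv OnePoint.infty = ((0 : ℂ) : OnePoint ℂ) := rfl

theorem sphereInv_coe {z : ℂ} (hz : z ≠ 0) :
    sphereInv (z : OnePoint ℂ) = ((z⁻¹ : ℂ) : OnePoint ℂ) :=
  if_neg hz

theorem sphereInv_sphereInv (x : OnePoint ℂ) : sphereInv (sphereInv x) = x := by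
  induction x with
  | infty => rw [sphereInv_infty, sphereInv_zero]
  | coe z =>
    by_cases hz : z = 0
    · rw [hz, sphereInv_zero, sphereInv_infty]
    · rw [sphereInv_coe hz, sphereInv_coe (inv_ne_zero hz), inv_inv]

theorem continuous_sphereInv : Continuous sphereInv := by
  have hc : coclosedCompact ℂ = Bornology.cobounded ℂ := by
    rw [coclosedCompact_eq_cocompact, Metric.cobounded_eq_cocompact]
  rw [OnePoint.continuous_iff, continuous_iff_continuousAt]
  refine ⟨?_, fun z => ?_⟩
  · rw [hc, sphereInv_infty]
    have h1 : Tendsto (fun z : ℂ => ((z⁻¹ : ℂ) : OnePoint ℂ)) (Bornology.cobounded ℂ)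
        (𝓝 ((0 : ℂ) : OnePoint ℂ)) :=
      (OnePoint.continuous_coe.tendsto 0).comp tendsto_inv₀_cobounded
    refine h1.congr' ?_
    filter_upwards [Bornology.eventually_ne_cobounded (0 : ℂ)] with z hz
    exact (sphereInv_coe hz).symm
  · by_cases hz : z = 0
    · subst hz
      rw [← continuousWithinAt_compl_self, ContinuousWithinAt, sphereInv_zero]
      have h1 : Tendsto (fun z : ℂ => ((z⁻¹ : ℂ) : OnePoint ℂ)) (𝓝[≠] 0)
          (𝓝 OnePoint.infty) := by
        refine OnePoint.tendsto_coe_infty.comp ?_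
        rw [hc]
        exact tendsto_inv₀_nhdsNE_zero
      refine h1.congr' ?_
      filter_upwards [self_mem_nhdsWithin] with z hz
      exact (sphereInv_coe hz).symm
    · have h1 : ContinuousAt (fun z : ℂ => ((z⁻¹ : ℂ) : OnePoint ℂ)) z :=
        OnePoint.continuous_coe.continuousAt.comp (continuousAt_inv₀ hz)
      refine h1.congr ?_
      filter_upwards [isOpen_ne.mem_nhds hz] with y hy
      exact (sphereInv_coe hy).symm

/-- The inversion `z ↦ 1 / z` as a homeomorphism of the Riemann sphere. -/
noncomputable def sphereInvHomeo : OnePoint ℂ ≃ₜ OnePoint ℂ where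
  toFun := sphereInv
  invFun := sphereInv
  left_inv := sphereInv_sphereInv
  right_inv := sphereInv_sphereInv
  continuous_toFun := continuous_sphereInv
  continuous_invFun := continuous_sphereInv

theorem sphereInvHomeo_mul_self : sphereInvHomeo * sphereInvHomeo = 1 :=
  Homeomorph.ext sphereInv_sphereInv

theorem eq_sphereInvHomeo_conj {n a : OnePoint ℂ ≃ₜ OnePoint ℂ}
    (h : sphereInvHomeo * n * sphereInvHomeo = a) : n = sphereInvHomeo * a * sphereInvHomeo := by
  rw [← h]
  calc n = 1 * n * 1 := by group
    _ = (sphereInvHomeo * sphereInvHomeo) * n * (sphereInvHomeo * sphereInvHomeo) := by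
      rw [sphereInvHomeo_mul_self]
    _ = _ := by group

theorem mem_discHomeos_conj_of_fixes_nhds {n : OnePoint ℂ ≃ₜ OnePoint ℂ} {x : ℂ} (hx : ‖x‖ < 1)
    (hn : ∀ᶠ z : ℂ in 𝓝 x, n (z : OnePoint ℂ) = z) :
    n ∈ (extendHom '' discHomeos) * ({sphereInvHomeo} * (extendHom '' discHomeos) *
      {sphereInvHomeo}) * (extendHom '' discHomeos) := by
  obtain ⟨ε, hε, hεn⟩ := Metric.eventually_nhds_iff_ball.1 hn
  obtain ⟨Φ, hΦ, hΦx⟩ := exists_homeomorph_shrinking hx hε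
  have hΦm : Φ ∈ discHomeos := hΦ
  have hfix : ∀ z : ℂ, ‖z‖ < 1 →
      ((extendHom Φ)⁻¹ * n * extendHom Φ) (z : OnePoint ℂ) = z := by
    intro z hz
    change (extendHom Φ).symm (n (Φ z : ℂ)) = z
    rw [hεn _ (hΦx z hz)]
    exact (extendHom Φ).symm_apply_apply (z : OnePoint ℂ)
  have hinf : (sphereInvHomeo * ((extendHom Φ)⁻¹ * n * extendHom Φ) * sphereInvHomeo)
      OnePoint.infty = OnePoint.infty := by
    change sphereInv (((extendHom Φ)⁻¹ * n * extendHom Φ) (sphereInv OnePoint.infty)) =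
      OnePoint.infty
    rw [sphereInv_infty, hfix 0 (by simp), sphereInv_zero]
  obtain ⟨f, hf⟩ := exists_extendHom_eq hinf
  have hfm : f ∈ discHomeos := by
    intro z hz
    have hz0 : z ≠ 0 := by
      rintro rfl
      norm_num at hz
    apply OnePoint.coe_injective
    rw [← extendHom_coe, hf]
    change sphereInv (((extendHom Φ)⁻¹ * n * extendHom Φ) (sphereInv (z : OnePoint ℂ))) = z
    rw [sphereInv_coe hz0, hfix, ← sphereInv_coe hz0, sphereInv_sphereInv]
    rw [norm_inv]
    exact inv_lt_one_of_one_lt₀ (by linarith)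
  have h2 : n = extendHom Φ * (sphereInvHomeo * extendHom f * sphereInvHomeo) * extendHom Φ⁻¹ := by
    rw [← eq_sphereInvHomeo_conj hf.symm, map_inv]
    group
  rw [h2]
  exact mul_mem_mul (mul_mem_mul (mem_image_of_mem _ hΦm) (mul_mem_mul (mul_mem_mul
    (mem_singleton _) (mem_image_of_mem _ hfm)) (mem_singleton _)))
    (mem_image_of_mem _ (inv_mem hΦm))

/-- The homeomorphisms of the Riemann sphere that fix some nonempty open set pointwise. -/
def partlyTrivialHomeos : Set (OnePoint ℂ ≃ₜ OnePoint ℂ) :=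
  {n | ∃ x : ℂ, ∀ᶠ z : ℂ in 𝓝 x, n (z : OnePoint ℂ) = z}

theorem uniformlyDistorted_partlyTrivialHomeos : UniformlyDistorted partlyTrivialHomeos := by
  set A : Set (OnePoint ℂ ≃ₜ OnePoint ℂ) := (extendHom '' discHomeos) * ({sphereInvHomeo} *
    (extendHom '' discHomeos) * {sphereInvHomeo}) * (extendHom '' discHomeos) with hA
  have hE := uniformlyDistorted_discHomeos.image extendHom
  have hJ : UniformlyDistorted ({sphereInvHomeo} : Set (OnePoint ℂ ≃ₜ OnePoint ℂ)) :=
    .of_finite (finite_singleton _)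
  have hAd : UniformlyDistorted A := (hE.mul ((hJ.mul hE).mul hJ)).mul hE
  have h1 : (1 : OnePoint ℂ ≃ₜ OnePoint ℂ) ∈ A :=
    mem_discHomeos_conj_of_fixes_nhds (x := 0) (by simp) (Eventually.of_forall fun z => rfl)
  refine (hAd.mul ((hJ.mul hAd).mul hJ)).mono ?_
  rintro n ⟨x, hx⟩
  have h2 : ∃ y : ℂ, (∀ᶠ z : ℂ in 𝓝 y, n (z : OnePoint ℂ) = z) ∧ ‖y‖ ≠ 1 := by
    by_contra! h
    have h3 : x ∈ interior (sphere (0 : ℂ) 1) := by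
      rw [mem_interior_iff_mem_nhds]
      filter_upwards [hx.eventually_nhds] with y hy
      exact mem_sphere_zero_iff_norm.2 (h y hy)
    rw [interior_sphere _ one_ne_zero] at h3
    exact h3
  obtain ⟨y, hy, hy1⟩ := h2
  rcases hy1.lt_or_gt with hy1 | hy1
  · rw [← mul_one n]
    refine mul_mem_mul (mem_discHomeos_conj_of_fixes_nhds hy1 hy) ?_
    rw [← sphereInvHomeo_mul_self]
    simpa using mul_mem_mul (mul_mem_mul (mem_singleton sphereInvHomeo) h1)
      (mem_singleton sphereInvHomeo)
  · have hy0 : y ≠ 0 := by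
      rintro rfl
      norm_num at hy1
    have h3 : sphereInvHomeo * n * sphereInvHomeo ∈ A := by
      refine mem_discHomeos_conj_of_fixes_nhds (x := y⁻¹) ?_ ?_
      · rw [norm_inv]
        exact inv_lt_one_of_one_lt₀ hy1
      · have h4 : Tendsto (fun z : ℂ => z⁻¹) (𝓝 y⁻¹) (𝓝 y) := by
          simpa using (continuousAt_inv₀ (inv_ne_zero hy0)).tendsto
        filter_upwards [h4.eventually hy, isOpen_ne.mem_nhds (inv_ne_zero hy0)] with z hz hz0
        change sphereInv (n (sphereInv (z : OnePoint ℂ))) = z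
        rw [sphereInv_coe hz0, hz, ← sphereInv_coe hz0, sphereInv_sphereInv]
    rw [← one_mul n, eq_sphereInvHomeo_conj (n := n) rfl]
    exact mul_mem_mul h1 (mul_mem_mul (mul_mem_mul (mem_singleton _) h3) (mem_singleton _))

theorem extendHom_mem_partlyTrivialHomeos {Φ : ℂ ≃ₜ ℂ} (h : ∃ R : ℝ, ∀ z, R ≤ ‖z‖ → Φ z = z) :
    extendHom Φ ∈ partlyTrivialHomeos := by
  obtain ⟨R, hR⟩ := h
  refine ⟨((|R| + 1 : ℝ) : ℂ), ?_⟩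
  have h1 : R < ‖((|R| + 1 : ℝ) : ℂ)‖ := by
    rw [Complex.norm_real, Real.norm_of_nonneg (by positivity)]
    linarith [le_abs_self R]
  filter_upwards [continuous_norm.continuousAt.eventually (lt_mem_nhds h1)] with z hz
  rw [extendHom_coe, hR z hz.le]

theorem extendHom_mem_partlyTrivialHomeos_of_halfPlane {H : ℂ ≃ₜ ℂ}
    (h : ∀ w : ℂ, w.im ≤ -1 → H w = w) : extendHom H ∈ partlyTrivialHomeos := by
  refine ⟨-2 * Complex.I, ?_⟩
  have h1 : (-2 * Complex.I : ℂ).im < -1 := by norm_num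
  filter_upwards [Complex.continuous_im.continuousAt.eventually (gt_mem_nhds h1)] with z hz
  rw [extendHom_coe, h z hz.le]

/-- The reflection of `ℂ` in the imaginary axis. -/
noncomputable def imaginaryReflection : ℂ ≃ₜ ℂ :=
  Complex.conjLIE.toHomeomorph.trans (Homeomorph.neg ℂ)

theorem imaginaryReflection_apply (z : ℂ) : imaginaryReflection z = -(starRingEnd ℂ) z := rfl

theorem extendHom_mem_product (g : ℂ ≃ₜ ℂ) :
    extendHom g ∈ partlyTrivialHomeos * (partlyTrivialHomeos *
      {1, (extendHom imaginaryReflection)⁻¹}) * partlyTrivialHomeos * partlyTrivialHomeos := by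
  obtain ⟨μ, ν, H, hμ, hμ', hH, hν, hν', hg, hHim⟩ := exists_local_factorisation g
  obtain ⟨Φ, hΦ, hΦμ⟩ := hasHomeomorphGerm_of_analyticAt hμ hμ'
  obtain ⟨Ψ, hΨ, hΨν⟩ := hasHomeomorphGerm_of_analyticAt hν hν'
  have hn : (extendHom Φ)⁻¹ * (extendHom H)⁻¹ * (extendHom Ψ)⁻¹ * extendHom g ∈
      partlyTrivialHomeos := by
    refine ⟨0, ?_⟩
    have h1 : Tendsto (fun z => H (μ z)) (𝓝 0) (𝓝 (μ 0)) := by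
      have h2 := H.continuous.continuousAt.comp hμ.continuousAt
      rw [ContinuousAt, Function.comp_apply, hH] at h2
      exact h2
    filter_upwards [hg, hΦμ, h1.eventually hΨν] with z h2 h3 h4
    have h5 : g z = Ψ (H (Φ z)) := by rw [h2, h3, h4]
    rw [← map_inv, ← map_inv, ← map_inv, ← map_mul, ← map_mul, ← map_mul, extendHom_coe]
    change ((Φ.symm (H.symm (Ψ.symm (g z))) : ℂ) : OnePoint ℂ) = z
    rw [h5, Ψ.symm_apply_apply, H.symm_apply_apply, Φ.symm_apply_apply]
  have hH2 : extendHom H ∈ partlyTrivialHomeos * {1, (extendHom imaginaryReflection)⁻¹} := by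
    rcases hHim with h | h
    · rw [← mul_one (extendHom H)]
      exact mul_mem_mul (extendHom_mem_partlyTrivialHomeos_of_halfPlane h) (by simp)
    · rw [← mul_inv_cancel_right (extendHom H) (extendHom imaginaryReflection), ← map_mul]
      refine mul_mem_mul (extendHom_mem_partlyTrivialHomeos_of_halfPlane fun w hw => ?_) (by simp)
      change H (imaginaryReflection w) = w
      rw [imaginaryReflection_apply, h _ (by simpa using hw)]
      simp
  have h6 : extendHom g = extendHom Ψ * extendHom H * extendHom Φ *
      ((extendHom Φ)⁻¹ * (extendHom H)⁻¹ * (extendHom Ψ)⁻¹ * extendHom g) := by group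
  rw [h6]
  exact mul_mem_mul (mul_mem_mul (mul_mem_mul (extendHom_mem_partlyTrivialHomeos hΨ) hH2)
    (extendHom_mem_partlyTrivialHomeos hΦ)) hn

theorem uniformlyDistorted_homeo_onePoint :
    UniformlyDistorted (univ : Set (OnePoint ℂ ≃ₜ OnePoint ℂ)) := by
  have hN := uniformlyDistorted_partlyTrivialHomeos
  have h1N : (1 : OnePoint ℂ ≃ₜ OnePoint ℂ) ∈ partlyTrivialHomeos :=
    ⟨0, Eventually.of_forall fun z => rfl⟩
  refine ((hN.mul (.of_finite (A := {1, sphereInvHomeo}) (by simp))).mul (((hN.mul (hN.mul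
    (.of_finite (A := {1, (extendHom imaginaryReflection)⁻¹}) (by simp)))).mul hN).mul hN)).mono ?_
  intro g _
  by_cases hg : g OnePoint.infty = OnePoint.infty
  · obtain ⟨f, rfl⟩ := exists_extendHom_eq hg
    rw [← one_mul (extendHom f), ← one_mul (1 : OnePoint ℂ ≃ₜ OnePoint ℂ)]
    exact mul_mem_mul (mul_mem_mul h1N (by simp)) (extendHom_mem_product f)
  · obtain ⟨a, ha⟩ := OnePoint.ne_infty_iff_exists.1 hg
    obtain ⟨T, ⟨R, hR⟩, hTa⟩ := hasHomeomorphGerm_add (-a) a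
    have hT0 : T a = 0 := hTa.self_of_nhds.trans (add_neg_cancel a)
    have h2 : (sphereInvHomeo * extendHom T * g) OnePoint.infty = OnePoint.infty := by
      change sphereInv (extendHom T (g OnePoint.infty)) = OnePoint.infty
      rw [← ha, extendHom_coe, hT0, sphereInv_zero]
    obtain ⟨f, hf⟩ := exists_extendHom_eq h2
    have h3 : g = extendHom T⁻¹ * sphereInvHomeo * extendHom f := by
      rw [hf, map_inv, show (extendHom T)⁻¹ * sphereInvHomeo * (sphereInvHomeo * extendHom T * g) =
        (extendHom T)⁻¹ * (sphereInvHomeo * sphereInvHomeo) * extendHom T * g by group,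
        sphereInvHomeo_mul_self]
      group
    rw [h3]
    refine mul_mem_mul (mul_mem_mul (extendHom_mem_partlyTrivialHomeos ⟨R, fun z hz => ?_⟩)
      (by simp)) (extendHom_mem_product f)
    exact T.symm_apply_eq.2 (hR z hz).symm

/-- Conjugation by a homeomorphism identifies homeomorphism groups. -/
def homeoConj {X Y : Type*} [TopologicalSpace X] [TopologicalSpace Y] (e : X ≃ₜ Y) :
    (X ≃ₜ X) →* (Y ≃ₜ Y) where
  toFun f := (e.symm.trans f).trans e
  map_one' := Homeomorph.ext fun y => e.apply_symm_apply y
  map_mul' f g := Homeomorph.ext fun y => by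
    change e (f (g (e.symm y))) = e (f (e.symm (e (g (e.symm y)))))
    rw [e.symm_apply_apply]

theorem homeoConj_surjective {X Y : Type*} [TopologicalSpace X] [TopologicalSpace Y] (e : X ≃ₜ Y) :
    Surjective (homeoConj e) := fun f =>
  ⟨homeoConj e.symm f, Homeomorph.ext fun y => by
    change e (e.symm (f (e (e.symm y)))) = f y
    simp⟩

theorem homeoConj_injective {X Y : Type*} [TopologicalSpace X] [TopologicalSpace Y] (e : X ≃ₜ Y) :
    Injective (homeoConj e) := fun f g h => Homeomorph.ext fun x => by
  have h1 : e (f (e.symm (e x))) = e (g (e.symm (e x))) := DFunLike.congr_fun h (e x)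
  rw [e.symm_apply_apply] at h1
  exact e.injective h1

theorem infinite_homeo_onePoint : Infinite (OnePoint ℂ ≃ₜ OnePoint ℂ) := by
  refine Infinite.of_injective (fun v : ℂ => extendHom (Homeomorph.addRight v)) fun v w h => ?_
  have h1 : extendHom (Homeomorph.addRight v) ((0 : ℂ) : OnePoint ℂ) =
    extendHom (Homeomorph.addRight w) ((0 : ℂ) : OnePoint ℂ) := DFunLike.congr_fun h _
  rw [extendHom_coe, extendHom_coe] at h1
  simpa using OnePoint.coe_injective h1

/-- The homeomorphism group of the 2-sphere is strongly distorted. -/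
theorem stronglyDistorted_homeo_sphere :
    StronglyDistorted
      ((Metric.sphere (0 : EuclideanSpace ℝ (Fin 3)) 1) ≃ₜ
        (Metric.sphere (0 : EuclideanSpace ℝ (Fin 3)) 1)) := by
  let e : OnePoint ℂ ≃ₜ Metric.sphere (0 : EuclideanSpace ℝ (Fin 3)) 1 :=
    onePointEquivSphereOfFinrankEq (by simp)
  have := infinite_homeo_onePoint
  have := Infinite.of_injective _ (homeoConj_injective e)
  refine UniformlyDistorted.stronglyDistorted
    ((uniformlyDistorted_homeo_onePoint.image (homeoConj e)).mono fun f _ => ?_)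
  rw [image_univ]
  exact homeoConj_surjective e f
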